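/- Let d ≥ 1 be an integer, let f : [0,∞) → (0,∞) be Lipschitz with f(s) ≤ f(0) =: θ for all s ≥ 0, let φ : B₁' → ℝ be of class C^{1,1}, and let u be a solution of the two-phase thin obstacle problem in B₁ with ∇u ∈ L²(B₁⁺). Then there exists C > 0, depending only on d, θ, ‖∇u‖_{L²(B₁⁺)}, the Lipschitz constant of f, and ‖φ‖_{C^{1,1}(B₁')}, such that |∂_y u(x,y)| ≤ θ + Cy for every (x,y) ∈ B_{1/2}⁺. -/

import Mathlib

open MeasureTheory Set

/-- Euclidean space `ℝ^d`. -/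
abbrev Esp (d : ℕ) := EuclideanSpace ℝ (Fin d)

/-- The upper half-ball `B_r⁺ = B_r ∩ {y > 0}` in `ℝ^{d+1} = ℝ^d × ℝ`. -/
def upBall (d : ℕ) (r : ℝ) : Set (Esp d × ℝ) := {p | ‖p.1‖^2 + p.2^2 < r^2 ∧ 0 < p.2}

/-- The thin ball `B_r' = B_r ∩ {y = 0}` in `ℝ^{d+1} = ℝ^d × ℝ`. -/
def flatBall (d : ℕ) (r : ℝ) : Set (Esp d × ℝ) := {p | ‖p.1‖^2 + p.2^2 < r^2 ∧ p.2 = 0}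

/-- Laplacian on `ℝ^d × ℝ`, computed through iterated coordinate derivatives. -/
noncomputable def lapH (d : ℕ) (u : Esp d × ℝ → ℝ) (p : Esp d × ℝ) : ℝ :=
  (∑ i : Fin d,
    deriv (deriv (fun t : ℝ => u (p.1 + t • EuclideanSpace.single i (1:ℝ), p.2))) 0)
  + deriv (deriv (fun t : ℝ => u (p.1, p.2 + t))) 0

/-- `u` is harmonic on the open set `U`: it is `C²` there and its Laplacian vanishes. -/
def HarmonicOnH (d : ℕ) (u : Esp d × ℝ → ℝ) (U : Set (Esp d × ℝ)) : Prop :=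
  ContDiffOn ℝ 2 u U ∧ ∀ p ∈ U, lapH d u p = 0

/-- Vertical partial derivative `∂_y u`. -/
noncomputable def pdy (d : ℕ) (u : Esp d × ℝ → ℝ) (p : Esp d × ℝ) : ℝ :=
  deriv (fun t : ℝ => u (p.1, p.2 + t)) 0

/-- Squared norm of the tangential gradient `|∇_x u|²`. -/
noncomputable def tangGradSq (d : ℕ) (u : Esp d × ℝ → ℝ) (p : Esp d × ℝ) : ℝ :=
  ∑ i : Fin d,
    (deriv (fun t : ℝ => u (p.1 + t • EuclideanSpace.single i (1:ℝ), p.2)) 0)^2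

/-- Squared norm of the full gradient `|∇u|²`. -/
noncomputable def gradSqH (d : ℕ) (u : Esp d × ℝ → ℝ) (p : Esp d × ℝ) : ℝ :=
  tangGradSq d u p + (pdy d u p)^2

/-- `L` is the one-sided vertical derivative `∂_y u(x,0⁺)`. -/
def NormalDeriv (d : ℕ) (u : Esp d × ℝ → ℝ) (x : Esp d) (L : ℝ) : Prop :=
  Filter.Tendsto (fun t => (u (x, t) - u (x, 0)) / t) (nhdsWithin 0 (Set.Ioi 0)) (nhds L)

/-- `f : [0,∞) → (0,∞)` is `L`-Lipschitz with `f ≤ f 0 = θ`. -/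
def GoodF (θ L : ℝ) (f : ℝ → ℝ) : Prop :=
  f 0 = θ ∧ (∀ s : ℝ, 0 ≤ s → 0 < f s ∧ f s ≤ θ) ∧
  (∀ s t : ℝ, 0 ≤ s → 0 ≤ t → |f s - f t| ≤ L * |s - t|)

/-- `u` is a solution of the two-phase thin obstacle problem in `B₁` with nonlinearity `f`
and obstacle `φ`: continuous on `B₁⁺ ∪ B₁'`, harmonic in `B₁⁺`, and on `B₁'` the one-sided
vertical derivative exists, is bounded by `θ` in absolute value, and equals
`f(|u−φ|)·sign(u−φ)` off the contact set. -/
def TwoPhaseSolH (d : ℕ) (θ : ℝ) (f : ℝ → ℝ) (φ : Esp d → ℝ) (u : Esp d × ℝ → ℝ) : Prop :=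
  ContinuousOn u (upBall d 1 ∪ flatBall d 1) ∧
  HarmonicOnH d u (upBall d 1) ∧
  ∀ x : Esp d, ‖x‖ < 1 → ∃ L : ℝ, NormalDeriv d u x L ∧ |L| ≤ θ ∧
    (u (x, 0) ≠ φ x → L = f |u (x, 0) - φ x| * Real.sign (u (x, 0) - φ x))

/-- `φ` is of class `C^{1,1}` on `B₁'` with `C^{1,1}` norm at most `P`. -/
def C11Bound (d : ℕ) (P : ℝ) (φ : Esp d → ℝ) : Prop :=
  (∀ x : Esp d, ‖x‖ < 1 → DifferentiableAt ℝ φ x ∧ |φ x| ≤ P ∧ ‖fderiv ℝ φ x‖ ≤ P) ∧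
  (∀ x y : Esp d, ‖x‖ < 1 → ‖y‖ < 1 → ‖fderiv ℝ φ x - fderiv ℝ φ y‖ ≤ P * ‖x - y‖)

open Filter Topology

section Slices

variable {E : Type*} [NormedAddCommGroup E] [NormedSpace ℝ E]

/-- Second derivative of `u` at `p` along the line in direction `v`. -/
noncomputable def lineDeriv2 (u : E → ℝ) (p v : E) : ℝ :=
  deriv (deriv (fun t : ℝ => u (p + t • v))) 0

theorem lineDeriv2_congr {u w : E → ℝ} {p : E} (h : u =ᶠ[𝓝 p] w) (v : E) :
    lineDeriv2 u p v = lineDeriv2 w p v := by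
  have hc : Tendsto (fun t : ℝ => p + t • v) (𝓝 0) (𝓝 p) := by
    have : ContinuousAt (fun t : ℝ => p + t • v) 0 := by fun_prop
    simpa [ContinuousAt] using this
  have h2 : (fun t : ℝ => u (p + t • v)) =ᶠ[𝓝 0] fun t => w (p + t • v) := hc.eventually h
  exact h2.deriv.deriv_eq

theorem ContDiffAt.slice {u : E → ℝ} {p : E} (h : ContDiffAt ℝ 2 u p) (v : E) :
    ContDiffAt ℝ 2 (fun t : ℝ => u (p + t • v)) 0 := by
  have h' : ContDiffAt ℝ 2 u (p + (0 : ℝ) • v) := by simpa using h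
  exact h'.comp (0 : ℝ) (f := fun t : ℝ => p + t • v) (by fun_prop)

theorem lineDeriv2_eq_iteratedDeriv (u : E → ℝ) (p v : E) :
    lineDeriv2 u p v = iteratedDeriv 2 (fun t : ℝ => u (p + t • v)) 0 := by
  simp [lineDeriv2, iteratedDeriv_succ, iteratedDeriv_zero]

theorem lineDeriv2_add {u w : E → ℝ} {p : E} (hu : ContDiffAt ℝ 2 u p)
    (hw : ContDiffAt ℝ 2 w p) (v : E) :
    lineDeriv2 (fun q => u q + w q) p v = lineDeriv2 u p v + lineDeriv2 w p v := by
  simp only [lineDeriv2_eq_iteratedDeriv]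
  exact iteratedDeriv_fun_add (hu.slice v) (hw.slice v)

theorem lineDeriv2_const_mul {u : E → ℝ} {p : E} (c : ℝ) (hu : ContDiffAt ℝ 2 u p) (v : E) :
    lineDeriv2 (fun q => c * u q) p v = c * lineDeriv2 u p v := by
  simp only [lineDeriv2_eq_iteratedDeriv]
  exact iteratedDeriv_const_mul (n := 2) c (hu.slice v)

theorem hasDerivAt_slice {u : E → ℝ} {p v : E} {t : ℝ} (h : DifferentiableAt ℝ u (p + t • v)) :
    HasDerivAt (fun t : ℝ => u (p + t • v)) (fderiv ℝ u (p + t • v) v) t := by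
  have h1 : HasDerivAt (fun t : ℝ => p + t • v) v t := by
    simpa using ((hasDerivAt_id t).smul_const v).const_add p
  exact h.hasFDerivAt.comp_hasDerivAt t h1

theorem lineDeriv2_eq_fderiv {u : E → ℝ} {p : E} (h : ContDiffAt ℝ 2 u p) (v : E) :
    lineDeriv2 u p v = fderiv ℝ (fun q => fderiv ℝ u q v) p v := by
  have hc : Tendsto (fun t : ℝ => p + t • v) (𝓝 0) (𝓝 p) := by
    have : ContinuousAt (fun t : ℝ => p + t • v) 0 := by fun_prop
    simpa [ContinuousAt] using this
  have h1 : ∀ᶠ q in 𝓝 p, DifferentiableAt ℝ u q := by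
    filter_upwards [h.eventually (by simp)] with q hq
    exact hq.differentiableAt (by norm_num)
  have h2 : deriv (fun t : ℝ => u (p + t • v)) =ᶠ[𝓝 0] fun t => fderiv ℝ u (p + t • v) v := by
    filter_upwards [hc.eventually h1] with t ht
    exact (hasDerivAt_slice ht).deriv
  have h3 : DifferentiableAt ℝ (fun q => fderiv ℝ u q v) p := by
    have : ContDiffAt ℝ 1 (fderiv ℝ u) p := h.fderiv_right (by norm_num)
    exact (this.differentiableAt (by norm_num)).clm_apply (differentiableAt_const v)
  rw [lineDeriv2, h2.deriv_eq]
  have h4 := hasDerivAt_slice (u := fun q => fderiv ℝ u q v) (p := p) (v := v) (t := 0)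
    (by simpa using h3)
  simpa using h4.deriv

theorem lineDeriv2_nonpos_of_isLocalMax {u : E → ℝ} {p : E} (h : IsLocalMax u p)
    (hc : ContinuousAt u p) (v : E) : lineDeriv2 u p v ≤ 0 := by
  have hc0 : ContinuousAt (fun t : ℝ => p + t • v) 0 := by fun_prop
  have ht : Tendsto (fun t : ℝ => p + t • v) (𝓝 0) (𝓝 p) := by simpa [ContinuousAt] using hc0
  have hmax : IsLocalMax (fun t : ℝ => u (p + t • v)) 0 := by
    filter_upwards [ht.eventually h] with t ht'
    simpa using ht'
  have hcont : ContinuousAt (fun t : ℝ => u (p + t • v)) 0 :=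
    ContinuousAt.comp (f := fun t : ℝ => p + t • v) (by simpa using hc) hc0
  by_contra! hpos
  have hmin := isLocalMin_of_deriv_deriv_pos hpos hmax.deriv_eq_zero hcont
  have hconst : (fun t : ℝ => u (p + t • v)) =ᶠ[𝓝 0] fun _ => u (p + (0 : ℝ) • v) := by
    filter_upwards [hmax, hmin] with t h1 h2
    exact le_antisymm h1 h2
  have : lineDeriv2 u p v = 0 := by
    rw [lineDeriv2, hconst.deriv.deriv_eq]
    simp
  linarith

end Slices

/-- The coordinate directions of `ℝ^d × ℝ`; `none` is the vertical one. -/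
noncomputable def coordDir (d : ℕ) : Option (Fin d) → Esp d × ℝ
  | none => (0, 1)
  | some i => (EuclideanSpace.single i 1, 0)

section Laplacian

variable {d : ℕ}

theorem lapH_eq_sum (u : Esp d × ℝ → ℝ) (p : Esp d × ℝ) :
    lapH d u p = ∑ j, lineDeriv2 u p (coordDir d j) := by
  rw [Fintype.sum_option, add_comm]
  simp only [lapH, lineDeriv2, coordDir]
  congr 1
  · refine Finset.sum_congr rfl fun i _ => ?_
    congr 2
    ext t
    congr 1
    ext <;> simp
  · congr 2
    ext t
    congr 1
    ext <;> simp

theorem pdy_eq (u : Esp d × ℝ → ℝ) (p : Esp d × ℝ) :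
    pdy d u p = deriv (fun t : ℝ => u (p + t • ((0, 1) : Esp d × ℝ))) 0 := by
  rw [pdy]
  congr 1
  ext t
  congr 1
  ext <;> simp

theorem lapH_congr {u w : Esp d × ℝ → ℝ} {p : Esp d × ℝ} (h : u =ᶠ[𝓝 p] w) :
    lapH d u p = lapH d w p := by
  simp only [lapH_eq_sum, lineDeriv2_congr h]

theorem lapH_add {u w : Esp d × ℝ → ℝ} {p : Esp d × ℝ} (hu : ContDiffAt ℝ 2 u p)
    (hw : ContDiffAt ℝ 2 w p) : lapH d (fun q => u q + w q) p = lapH d u p + lapH d w p := by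
  simp only [lapH_eq_sum, lineDeriv2_add hu hw, Finset.sum_add_distrib]

theorem lapH_const_mul {u : Esp d × ℝ → ℝ} {p : Esp d × ℝ} (c : ℝ) (hu : ContDiffAt ℝ 2 u p) :
    lapH d (fun q => c * u q) p = c * lapH d u p := by
  simp only [lapH_eq_sum, lineDeriv2_const_mul c hu, Finset.mul_sum]

theorem lapH_sub {u w : Esp d × ℝ → ℝ} {p : Esp d × ℝ} (hu : ContDiffAt ℝ 2 u p)
    (hw : ContDiffAt ℝ 2 w p) : lapH d (fun q => u q - w q) p = lapH d u p - lapH d w p := by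
  have h := lapH_add hu (contDiffAt_const (c := (-1 : ℝ)).mul hw)
  rw [lapH_const_mul _ hw] at h
  rw [sub_eq_add_neg, neg_eq_neg_one_mul, ← h]
  congr 1
  ext q
  ring

theorem lapH_nonpos_of_isLocalMax {u : Esp d × ℝ → ℝ} {p : Esp d × ℝ} (h : IsLocalMax u p)
    (hc : ContinuousAt u p) : lapH d u p ≤ 0 := by
  rw [lapH_eq_sum]
  exact Finset.sum_nonpos fun j _ => lineDeriv2_nonpos_of_isLocalMax h hc _

end Laplacian

section MeanValue

variable {d : ℕ}

/-- The coordinate of `q` along `coordDir d j`. -/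
def coordVal (j : Option (Fin d)) (q : Esp d × ℝ) : ℝ :=
  match j with
  | none => q.2
  | some i => q.1 i

/-- The squared Euclidean norm on `ℝ^d × ℝ`. -/
noncomputable def euclSq (q : Esp d × ℝ) : ℝ := ‖q.1‖ ^ 2 + q.2 ^ 2

/-- The radial weight `(1 - |q|²)₊²`. -/
noncomputable def radialWeight (q : Esp d × ℝ) : ℝ := (max 0 (1 - euclSq q)) ^ 2

/-- The potential `(1 - |q|²)₊³`, whose gradient is `-6 (1 - |q|²)₊² q`. -/
noncomputable def radialPotential (q : Esp d × ℝ) : ℝ := (max 0 (1 - euclSq q)) ^ 3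

instance : (volume : Measure (Esp d × ℝ)).IsAddHaarMeasure :=
  Measure.prod.instIsAddHaarMeasure _ _

theorem sum_coordVal_smul (q : Esp d × ℝ) : ∑ j, coordVal j q • coordDir d j = q := by
  rw [Fintype.sum_option]
  ext i
  · simp [coordVal, coordDir, Prod.fst_sum, Pi.single_apply]
  · simp [coordVal, coordDir, Prod.snd_sum]

theorem norm_sq_add_smul_single (x : Esp d) (i : Fin d) (t : ℝ) :
    ‖x + t • EuclideanSpace.single i (1 : ℝ)‖ ^ 2 = ‖x‖ ^ 2 + 2 * x i * t + t ^ 2 := by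
  rw [norm_add_sq_real, inner_smul_right, norm_smul, EuclideanSpace.inner_single_right]
  simp
  ring

theorem euclSq_add_smul_coordDir (q : Esp d × ℝ) (j : Option (Fin d)) (t : ℝ) :
    euclSq (q + t • coordDir d j) = euclSq q + 2 * coordVal j q * t + t ^ 2 := by
  cases j with
  | none => simp [euclSq, coordVal, coordDir]; ring
  | some i => simp [euclSq, coordVal, coordDir, norm_sq_add_smul_single]; ring

theorem norm_le_one_of_euclSq_le_one {q : Esp d × ℝ} (h : euclSq q ≤ 1) : ‖q‖ ≤ 1 := by
  unfold euclSq at h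
  rw [Prod.norm_def]
  apply max_le
  · exact abs_le_one_iff_mul_self_le_one.2 (by nlinarith [sq_nonneg q.2]) |> (le_abs_self _).trans
  · rw [Real.norm_eq_abs]
    exact abs_le_one_iff_mul_self_le_one.2 (by nlinarith [sq_nonneg ‖q.1‖])

theorem continuous_euclSq : Continuous (euclSq (d := d)) := by unfold euclSq; fun_prop

theorem continuous_radialWeight : Continuous (radialWeight (d := d)) := by
  have := continuous_euclSq (d := d)
  unfold radialWeight; fun_prop

theorem continuous_radialPotential : Continuous (radialPotential (d := d)) := by
  have := continuous_euclSq (d := d)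
  unfold radialPotential; fun_prop

theorem radialWeight_nonneg (q : Esp d × ℝ) : 0 ≤ radialWeight q := by
  unfold radialWeight; positivity

theorem radialWeight_eq_zero {q : Esp d × ℝ} (h : 1 ≤ euclSq q) : radialWeight q = 0 := by
  simp [radialWeight, max_eq_left (show 1 - euclSq q ≤ 0 by linarith)]

theorem radialPotential_eq_zero {q : Esp d × ℝ} (h : 1 ≤ euclSq q) : radialPotential q = 0 := by
  simp [radialPotential, max_eq_left (show 1 - euclSq q ≤ 0 by linarith)]

theorem hasCompactSupport_of_euclSq {f : Esp d × ℝ → ℝ} (h : ∀ q, 1 ≤ euclSq q → f q = 0) :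
    HasCompactSupport f := by
  apply HasCompactSupport.intro (isCompact_closedBall (0 : Esp d × ℝ) 1)
  intro q hq
  apply h
  by_contra! hlt
  exact hq (by simpa using norm_le_one_of_euclSq_le_one hlt.le)

theorem hasCompactSupport_radialWeight : HasCompactSupport (radialWeight (d := d)) :=
  hasCompactSupport_of_euclSq fun _ => radialWeight_eq_zero

theorem integral_radialWeight_pos : 0 < ∫ q : Esp d × ℝ, radialWeight q :=
  continuous_radialWeight.integral_pos_of_hasCompactSupport_nonneg_nonzero
    hasCompactSupport_radialWeight (fun q => radialWeight_nonneg q)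
    (x := 0) (by simp [radialWeight, euclSq])

theorem hasDerivAt_max_zero_pow_three (s : ℝ) :
    HasDerivAt (fun s : ℝ => (max 0 s) ^ 3) (3 * (max 0 s) ^ 2) s := by
  rcases lt_trichotomy s 0 with h | rfl | h
  · have : (fun s : ℝ => (max 0 s) ^ 3) =ᶠ[𝓝 s] fun _ => 0 := by
      filter_upwards [gt_mem_nhds h] with t ht
      simp [max_eq_left ht.le]
    simpa [max_eq_left h.le] using (hasDerivAt_const s (0 : ℝ)).congr_of_eventuallyEq this
  · rw [hasDerivAt_iff_tendsto_slope_zero]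
    have hc : Tendsto (fun t : ℝ => (max 0 t) ^ 2) (𝓝[≠] 0) (𝓝 0) := by
      have : ContinuousAt (fun t : ℝ => (max 0 t) ^ 2) 0 := by fun_prop
      simpa [ContinuousAt] using this.tendsto.mono_left nhdsWithin_le_nhds
    simp only [max_self, ne_eq, OfNat.ofNat_ne_zero, not_false_eq_true, zero_pow, mul_zero,
      zero_add, sub_zero, smul_eq_mul]
    refine hc.congr' ?_
    filter_upwards [self_mem_nhdsWithin] with t ht
    have ht' : t ≠ 0 := ht
    rcases le_total t 0 with h | h
    · simp [max_eq_left h]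
    · rw [max_eq_right h]; field_simp
  · have : (fun s : ℝ => (max 0 s) ^ 3) =ᶠ[𝓝 s] fun s => s ^ 3 := by
      filter_upwards [lt_mem_nhds h] with t ht
      simp [max_eq_right ht.le]
    rw [max_eq_right h.le]
    exact_mod_cast (hasDerivAt_pow 3 s).congr_of_eventuallyEq this

theorem hasLineDerivAt_radialPotential (q : Esp d × ℝ) (j : Option (Fin d)) :
    HasLineDerivAt ℝ radialPotential (-6 * radialWeight q * coordVal j q) q (coordDir d j) := by
  unfold HasLineDerivAt
  have h1 : HasDerivAt (fun t : ℝ => 1 - euclSq (q + t • coordDir d j))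
      (-(2 * coordVal j q)) 0 := by
    simp only [euclSq_add_smul_coordDir]
    have h := ((((hasDerivAt_id (0 : ℝ)).const_mul (2 * coordVal j q)).const_add
      (euclSq q)).add (hasDerivAt_pow 2 (0 : ℝ))).const_sub 1
    simpa using h
  have h2 : HasDerivAt (fun s : ℝ => (max 0 s) ^ 3) (3 * (max 0 (1 - euclSq q)) ^ 2)
      (1 - euclSq (q + (0 : ℝ) • coordDir d j)) := by
    simpa using hasDerivAt_max_zero_pow_three (1 - euclSq q)
  have h3 := h2.comp (0 : ℝ) h1
  have e : -6 * radialWeight q * coordVal j q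
      = 3 * (max 0 (1 - euclSq q)) ^ 2 * -(2 * coordVal j q) := by
    unfold radialWeight; ring
  rw [e]
  exact h3

theorem contDiff_fderiv_apply {U : Esp d × ℝ → ℝ} (hU : ContDiff ℝ 2 U) (v : Esp d × ℝ) :
    ContDiff ℝ 1 (fun q => fderiv ℝ U q v) :=
  (hU.fderiv_right (m := 1) (by norm_num)).clm_apply contDiff_const

theorem integral_fderiv_mul_radialWeight {U : Esp d × ℝ → ℝ} (hU : ContDiff ℝ 2 U)
    (p : Esp d × ℝ) (r : ℝ) (hh : ∀ q, euclSq q < 1 → lapH d U (p + r • q) = 0) :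
    ∫ q, fderiv ℝ U (p + r • q) q * radialWeight q = 0 := by
  have hcw := continuous_radialWeight (d := d)
  have hcp := continuous_radialPotential (d := d)
  have hcv : ∀ j : Option (Fin d), Continuous (coordVal j) := by
    intro j; cases j <;> (unfold coordVal; fun_prop)
  have hcd : ∀ j, Continuous fun q => fderiv ℝ U (p + r • q) (coordDir d j) := fun j =>
    (contDiff_fderiv_apply hU (coordDir d j)).continuous.comp (by fun_prop)
  have hcd2 : ∀ j, Continuous fun q => lineDeriv2 U (p + r • q) (coordDir d j) := by
    intro j
    have h1 : (fun q => lineDeriv2 U (p + r • q) (coordDir d j)) = fun q =>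
        fderiv ℝ (fun q => fderiv ℝ U q (coordDir d j)) (p + r • q) (coordDir d j) := by
      ext q
      exact lineDeriv2_eq_fderiv hU.contDiffAt _
    rw [h1]
    have := (contDiff_fderiv_apply hU (coordDir d j)).continuous_fderiv (by norm_num)
    fun_prop
  have hi1 : ∀ j, Integrable fun q => fderiv ℝ U (p + r • q) (coordDir d j) *
      (-6 * radialWeight q * coordVal j q) := by
    intro j
    apply Continuous.integrable_of_hasCompactSupport
    · have := hcd j; have := hcv j; fun_prop
    · exact hasCompactSupport_of_euclSq fun q hq => by simp [radialWeight_eq_zero hq]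
  have hi2 : ∀ j, Integrable fun q => r * lineDeriv2 U (p + r • q) (coordDir d j) *
      radialPotential q := by
    intro j
    apply Continuous.integrable_of_hasCompactSupport
    · have := hcd2 j; fun_prop
    · exact hasCompactSupport_of_euclSq fun q hq => by simp [radialPotential_eq_zero hq]
  have hi3 : ∀ j, Integrable fun q => fderiv ℝ U (p + r • q) (coordDir d j) *
      radialPotential q := by
    intro j
    apply Continuous.integrable_of_hasCompactSupport
    · have := hcd j; fun_prop
    · exact hasCompactSupport_of_euclSq fun q hq => by simp [radialPotential_eq_zero hq]
  have hparts : ∀ j, ∫ q, fderiv ℝ U (p + r • q) (coordDir d j) *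
      (-6 * radialWeight q * coordVal j q) =
      -∫ q, r * lineDeriv2 U (p + r • q) (coordDir d j) * radialPotential q := by
    intro j
    refine integral_bilinear_hasLineDerivAt_right_eq_neg_left_of_integrable
      (B := ContinuousLinearMap.mul ℝ ℝ) (v := coordDir d j) (hi2 j) (hi1 j) (hi3 j) ?_ ?_
    · intro q _
      rw [lineDeriv2_eq_fderiv hU.contDiffAt]
      unfold HasLineDerivAt
      have h1 := hasDerivAt_slice (u := fun q => fderiv ℝ U q (coordDir d j)) (p := p + r • q)
        (v := coordDir d j) (t := r * 0)
        ((contDiff_fderiv_apply hU _).differentiable (by norm_num) _)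
      have h2 : HasDerivAt (fun t : ℝ => r * t) r 0 := by
        simpa using (hasDerivAt_id (0 : ℝ)).const_mul r
      have h3 := h1.comp (0 : ℝ) h2
      have e1 : (fun t : ℝ => fderiv ℝ U (p + r • (q + t • coordDir d j)) (coordDir d j)) =
          (fun t : ℝ => fderiv ℝ U (p + r • q + t • coordDir d j) (coordDir d j)) ∘
            fun t => r * t := by
        ext t
        simp only [Function.comp_apply, smul_add, smul_smul, add_assoc]
      rw [e1, mul_comm]
      simpa only [mul_zero, zero_smul, add_zero] using h3
    · intro q _
      exact hasLineDerivAt_radialPotential q j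
  have e1 : ∀ q, fderiv ℝ U (p + r • q) q * radialWeight q =
      -(1 / 6) * ∑ j, fderiv ℝ U (p + r • q) (coordDir d j) *
        (-6 * radialWeight q * coordVal j q) := by
    intro q
    have e : fderiv ℝ U (p + r • q) q
        = ∑ j, fderiv ℝ U (p + r • q) (coordVal j q • coordDir d j) := by
      rw [← map_sum, sum_coordVal_smul]
    rw [e, Finset.sum_mul, Finset.mul_sum]
    refine Finset.sum_congr rfl fun j _ => ?_
    rw [map_smul, smul_eq_mul]
    ring
  simp only [e1]
  rw [integral_const_mul, integral_finsetSum _ fun j _ => hi1 j]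
  simp only [hparts]
  rw [Finset.sum_neg_distrib, ← integral_finsetSum _ fun j _ => hi2 j]
  have e2 : ∀ q, ∑ j, r * lineDeriv2 U (p + r • q) (coordDir d j) * radialPotential q = 0 := by
    intro q
    rw [← Finset.sum_mul, ← Finset.mul_sum, ← lapH_eq_sum]
    rcases lt_or_ge (euclSq q) 1 with h | h
    · simp [hh q h]
    · simp [radialPotential_eq_zero h]
  simp [e2]

theorem integral_mul_radialWeight {U : Esp d × ℝ → ℝ} (hU : ContDiff ℝ 2 U)
    (hc : HasCompactSupport U) (p : Esp d × ℝ) {R : ℝ} (hR : 0 ≤ R)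
    (hh : ∀ r ∈ Icc 0 R, ∀ q, euclSq q < 1 → lapH d U (p + r • q) = 0) :
    ∫ q, U (p + R • q) * radialWeight q = U p * ∫ q : Esp d × ℝ, radialWeight q := by
  have hcw := continuous_radialWeight (d := d)
  have hcU := hU.continuous
  have hcU' := hU.continuous_fderiv (by norm_num)
  obtain ⟨B, hB⟩ := (hc.fderiv (𝕜 := ℝ)).exists_bound_of_continuous hcU'
  have hint : ∀ r : ℝ, Integrable fun q => U (p + r • q) * radialWeight q := by
    intro r
    apply Continuous.integrable_of_hasCompactSupport
    · fun_prop
    · exact hasCompactSupport_of_euclSq fun q hq => by simp [radialWeight_eq_zero hq]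
  have hd : ∀ r : ℝ, HasDerivAt (fun r : ℝ => ∫ q, U (p + r • q) * radialWeight q)
      (∫ q, fderiv ℝ U (p + r • q) q * radialWeight q) r := by
    intro r
    refine (hasDerivAt_integral_of_dominated_loc_of_deriv_le (s := univ) (x₀ := r)
      (F := fun (r : ℝ) q => U (p + r • q) * radialWeight q)
      (F' := fun (r : ℝ) q => fderiv ℝ U (p + r • q) q * radialWeight q)
      (bound := fun q => B * ‖q‖ * radialWeight q) univ_mem
      (Eventually.of_forall fun r => (hint r).aestronglyMeasurable) (hint r)
      ?_ ?_ ?_ ?_).2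
    · apply Continuous.aestronglyMeasurable
      fun_prop
    · refine Eventually.of_forall fun q r _ => ?_
      rw [norm_mul, Real.norm_of_nonneg (radialWeight_nonneg q)]
      exact mul_le_mul_of_nonneg_right
        ((ContinuousLinearMap.le_opNorm _ _).trans
          (mul_le_mul_of_nonneg_right (hB _) (norm_nonneg _))) (radialWeight_nonneg q)
    · apply Continuous.integrable_of_hasCompactSupport
      · fun_prop
      · exact hasCompactSupport_of_euclSq fun q hq => by simp [radialWeight_eq_zero hq]
    · refine Eventually.of_forall fun q r _ => ?_
      exact (hasDerivAt_slice (hU.differentiable (by norm_num) _)).mul_const _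
  have hconst := constant_of_has_deriv_right_zero (a := 0) (b := R)
    (f := fun r : ℝ => ∫ q, U (p + r • q) * radialWeight q)
    (fun r _ => (hd r).continuousAt.continuousWithinAt)
    (fun r hr => by
      have := hd r
      rw [integral_fderiv_mul_radialWeight hU p r (hh r ⟨hr.1, hr.2.le⟩)] at this
      exact this.hasDerivWithinAt) R ⟨hR, le_rfl⟩
  simp only [zero_smul, add_zero] at hconst
  rw [hconst, integral_const_mul]

theorem integral_radialWeight_smul_fderiv {U : Esp d × ℝ → ℝ} (hU : ContDiff ℝ 2 U)
    (hc : HasCompactSupport U) (p : Esp d × ℝ) {R : ℝ} (hR : 0 ≤ R)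
    (hh : ∀ᶠ p' in 𝓝 p, ∀ r ∈ Icc 0 R, ∀ q, euclSq q < 1 → lapH d U (p' + r • q) = 0) :
    ∫ q, radialWeight q • fderiv ℝ U (p + R • q)
      = (∫ q : Esp d × ℝ, radialWeight q) • fderiv ℝ U p := by
  have hcw := continuous_radialWeight (d := d)
  have hcU := hU.continuous
  have hcU' := hU.continuous_fderiv (by norm_num)
  obtain ⟨B, hB⟩ := (hc.fderiv (𝕜 := ℝ)).exists_bound_of_continuous hcU'
  have hint : ∀ p : Esp d × ℝ, Integrable fun q => U (p + R • q) * radialWeight q := by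
    intro r
    apply Continuous.integrable_of_hasCompactSupport
    · fun_prop
    · exact hasCompactSupport_of_euclSq fun q hq => by simp [radialWeight_eq_zero hq]
  have h1 : HasFDerivAt (fun p => ∫ q, U (p + R • q) * radialWeight q)
      (∫ q, radialWeight q • fderiv ℝ U (p + R • q)) p := by
    refine hasFDerivAt_integral_of_dominated_of_fderiv_le (s := univ)
      (F := fun p q => U (p + R • q) * radialWeight q)
      (F' := fun p q => radialWeight q • fderiv ℝ U (p + R • q))
      (bound := fun q => B * radialWeight q) univ_mem
      (Eventually.of_forall fun r => (hint r).aestronglyMeasurable) (hint p) ?_ ?_ ?_ ?_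
    · apply Continuous.aestronglyMeasurable
      fun_prop
    · refine Eventually.of_forall fun q r _ => ?_
      rw [norm_smul, Real.norm_of_nonneg (radialWeight_nonneg q), mul_comm]
      exact mul_le_mul_of_nonneg_right (hB _) (radialWeight_nonneg q)
    · apply Continuous.integrable_of_hasCompactSupport
      · fun_prop
      · exact hasCompactSupport_of_euclSq fun q hq => by simp [radialWeight_eq_zero hq]
    · refine Eventually.of_forall fun q r _ => ?_
      have h := (hU.differentiable (by norm_num) (r + R • q)).hasFDerivAt
      exact ((hasFDerivAt_comp_add_right (R • q)).2 h).mul_const (radialWeight q)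
  have h2 : HasFDerivAt (fun p => U p * ∫ q : Esp d × ℝ, radialWeight q)
      ((∫ q : Esp d × ℝ, radialWeight q) • fderiv ℝ U p) p :=
    (hU.differentiable (by norm_num) p).hasFDerivAt.mul_const _
  refine h1.unique (h2.congr_of_eventuallyEq ?_)
  filter_upwards [hh] with p' hp'
  exact integral_mul_radialWeight hU hc p' hR hp'

end MeanValue

section GradientBound

variable {d : ℕ}

theorem isOpen_upBall (d : ℕ) (r : ℝ) : IsOpen (upBall d r) := by
  have h1 : IsOpen {p : Esp d × ℝ | ‖p.1‖ ^ 2 + p.2 ^ 2 < r ^ 2} :=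
    isOpen_lt (by fun_prop) (by fun_prop)
  have h2 : IsOpen {p : Esp d × ℝ | 0 < p.2} := isOpen_lt (by fun_prop) (by fun_prop)
  exact h1.inter h2

theorem pdy_eq_fderiv {u : Esp d × ℝ → ℝ} {p : Esp d × ℝ} (h : DifferentiableAt ℝ u p) :
    pdy d u p = fderiv ℝ u p (0, 1) := by
  rw [pdy_eq]
  have := hasDerivAt_slice (u := u) (p := p) (v := (0, 1)) (t := 0) (by simpa using h)
  simpa using this.deriv

theorem gradSqH_eq_sum {u : Esp d × ℝ → ℝ} {p : Esp d × ℝ} (h : DifferentiableAt ℝ u p) :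
    gradSqH d u p = ∑ j, (fderiv ℝ u p (coordDir d j)) ^ 2 := by
  rw [Fintype.sum_option, add_comm, gradSqH, tangGradSq, pdy_eq_fderiv h]
  congr 1
  refine Finset.sum_congr rfl fun i _ => ?_
  have h1 := hasDerivAt_slice (u := u) (p := p) (v := coordDir d (some i)) (t := 0)
    (by simpa using h)
  have h2 : (fun t : ℝ => u (p.1 + t • EuclideanSpace.single i (1 : ℝ), p.2)) =
      fun t : ℝ => u (p + t • coordDir d (some i)) := by
    ext t
    congr 1
    ext <;> simp [coordDir]
  rw [h2, h1.deriv]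
  simp

theorem gradSqH_nonneg (u : Esp d × ℝ → ℝ) (p : Esp d × ℝ) : 0 ≤ gradSqH d u p := by
  unfold gradSqH tangGradSq
  positivity

theorem sum_coordVal_sq (q : Esp d × ℝ) : ∑ j, coordVal j q ^ 2 = euclSq q := by
  rw [Fintype.sum_option, euclSq, EuclideanSpace.norm_sq_eq, add_comm]
  simp [coordVal]

theorem norm_fderiv_sq_le {u : Esp d × ℝ → ℝ} {p : Esp d × ℝ} (h : DifferentiableAt ℝ u p) :
    ‖fderiv ℝ u p‖ ^ 2 ≤ 2 * gradSqH d u p := by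
  have hle : ‖fderiv ℝ u p‖ ≤ √(2 * gradSqH d u p) := by
    refine ContinuousLinearMap.opNorm_le_bound _ (by positivity) fun v => ?_
    have h1 : fderiv ℝ u p v = ∑ j, coordVal j v * fderiv ℝ u p (coordDir d j) := by
      conv_lhs => rw [← sum_coordVal_smul v]
      simp only [map_sum, map_smul, smul_eq_mul]
    have h2 : (fderiv ℝ u p v) ^ 2 ≤ euclSq v * gradSqH d u p := by
      rw [h1, gradSqH_eq_sum h, ← sum_coordVal_sq]
      exact Finset.sum_mul_sq_le_sq_mul_sq _ _ _
    have h3 : euclSq v ≤ 2 * ‖v‖ ^ 2 := by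
      have a := pow_le_pow_left₀ (norm_nonneg _) (norm_fst_le v) 2
      have b := pow_le_pow_left₀ (norm_nonneg _) (norm_snd_le v) 2
      rw [Real.norm_eq_abs, sq_abs] at b
      unfold euclSq
      linarith
    rw [Real.norm_eq_abs]
    refine abs_le_of_sq_le_sq ?_ (by positivity)
    rw [mul_pow, Real.sq_sqrt (by have := gradSqH_nonneg u p; positivity)]
    have := mul_le_mul_of_nonneg_right h3 (gradSqH_nonneg u p)
    linarith
  calc ‖fderiv ℝ u p‖ ^ 2 ≤ √(2 * gradSqH d u p) ^ 2 := by gcongr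
    _ = _ := Real.sq_sqrt (by have := gradSqH_nonneg u p; positivity)

/-- A function that is `C²` near a closed ball agrees near a smaller closed ball with a compactly
supported `C²` function. -/
theorem exists_contDiff_eqOn_ball {u : Esp d × ℝ → ℝ} {Ω : Set (Esp d × ℝ)} (hΩ : IsOpen Ω)
    (hu : ContDiffOn ℝ 2 u Ω) {p : Esp d × ℝ} {r R : ℝ} (hr : 0 < r) (hrR : r < R)
    (hR : Metric.closedBall p R ⊆ Ω) :
    ∃ U : Esp d × ℝ → ℝ, ContDiff ℝ 2 U ∧ HasCompactSupport U ∧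
      EqOn U u (Metric.ball p r) := by
  let χ : ContDiffBump p := ⟨r, R, hr, hrR⟩
  refine ⟨fun q => χ q * u q, ?_, χ.hasCompactSupport.mul_right, ?_⟩
  · rw [contDiff_iff_contDiffAt]
    intro q
    by_cases hq : q ∈ tsupport χ
    · have hq' : q ∈ Ω := by
        rw [χ.tsupport_eq] at hq
        exact hR hq
      exact χ.contDiff.contDiffAt.mul (hu.contDiffAt (hΩ.mem_nhds hq'))
    · have : (fun q => χ q * u q) =ᶠ[𝓝 q] fun _ => 0 := by
        filter_upwards [(isClosed_tsupport _).isOpen_compl.mem_nhds hq] with x hx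
        simp [image_eq_zero_of_notMem_tsupport hx]
      exact contDiffAt_const.congr_of_eventuallyEq this
  · intro q hq
    simp [χ.one_of_mem_closedBall (Metric.ball_subset_closedBall hq)]

theorem norm_fderiv_le_of_closedBall_subset {u : Esp d × ℝ → ℝ} {Ω : Set (Esp d × ℝ)}
    (hΩ : IsOpen Ω) (hu : HarmonicOnH d u Ω) (hint : IntegrableOn (gradSqH d u) Ω)
    {p : Esp d × ℝ} {R : ℝ} (hR : 0 < R) (hball : Metric.closedBall p (2 * R) ⊆ Ω) :
    (∫ q : Esp d × ℝ, radialWeight q) * ‖fderiv ℝ u p‖ ≤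
      (∫ q : Esp d × ℝ, radialWeight q ^ 2) +
        (R ^ (d + 1))⁻¹ * ∫ q in Ω, gradSqH d u q := by
  obtain ⟨U, hU, hUc, hUu⟩ := exists_contDiff_eqOn_ball hΩ hu.1 (r := 3 / 2 * R) (R := 2 * R)
    (by positivity) (by linarith) hball
  have hsub : Metric.ball p (3 / 2 * R) ⊆ Ω :=
    (Metric.ball_subset_closedBall.trans (Metric.closedBall_subset_closedBall (by linarith))).trans
      hball
  have hev : ∀ q ∈ Metric.ball p (3 / 2 * R), U =ᶠ[𝓝 q] u := fun q hq =>
    Filter.eventuallyEq_of_mem (Metric.isOpen_ball.mem_nhds hq) hUu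
  have hmem : ∀ p' ∈ Metric.ball p (R / 2), ∀ r ∈ Icc 0 R, ∀ q, euclSq q < 1 →
      p' + r • q ∈ Metric.ball p (3 / 2 * R) := by
    intro p' hp' r hr q hq
    rw [Metric.mem_ball, dist_eq_norm] at hp' ⊢
    have h1 := norm_le_one_of_euclSq_le_one hq.le
    have h2 : ‖r • q‖ ≤ R := by
      rw [norm_smul, Real.norm_of_nonneg hr.1]
      nlinarith [hr.1, hr.2, norm_nonneg q]
    have h3 : p' + r • q - p = (p' - p) + r • q := by abel
    rw [h3]
    have := norm_add_le (p' - p) (r • q)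
    linarith
  have hmv := integral_radialWeight_smul_fderiv hU hUc p hR.le (by
    filter_upwards [Metric.ball_mem_nhds p (half_pos hR)] with p' hp' r hr q hq
    have := hmem p' hp' r hr q hq
    rw [lapH_congr (hev _ this)]
    exact hu.2 _ (hsub this))
  rw [(hev p (Metric.mem_ball_self (by positivity))).fderiv_eq] at hmv
  have hm := integral_radialWeight_pos (d := d)
  have hF : Integrable (Ω.indicator (gradSqH d u)) := hint.integrable_indicator hΩ.measurableSet
  have hF2 : Integrable fun q => Ω.indicator (gradSqH d u) (p + R • q) := by
    have h1 : Integrable fun q => Ω.indicator (gradSqH d u) (p + q) := hF.comp_add_left p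
    exact h1.comp_smul hR.ne'
  have hw2 : Integrable fun q : Esp d × ℝ => radialWeight q ^ 2 := by
    apply Continuous.integrable_of_hasCompactSupport
    · have := continuous_radialWeight (d := d); fun_prop
    · exact hasCompactSupport_of_euclSq fun q hq => by simp [radialWeight_eq_zero hq]
  have hval : ∫ q, Ω.indicator (gradSqH d u) (p + R • q) =
      (R ^ (d + 1))⁻¹ * ∫ q in Ω, gradSqH d u q := by
    rw [Measure.integral_comp_smul volume (fun q => Ω.indicator (gradSqH d u) (p + q)) R,
      integral_add_left_eq_self (fun q => Ω.indicator (gradSqH d u) q) p,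
      integral_indicator hΩ.measurableSet, abs_of_pos (by positivity)]
    simp
  calc (∫ q : Esp d × ℝ, radialWeight q) * ‖fderiv ℝ u p‖
      = ‖(∫ q : Esp d × ℝ, radialWeight q) • fderiv ℝ u p‖ := by
        rw [norm_smul, Real.norm_of_nonneg hm.le]
    _ = ‖∫ q, radialWeight q • fderiv ℝ U (p + R • q)‖ := by rw [hmv]
    _ ≤ ∫ q, (radialWeight q ^ 2 + Ω.indicator (gradSqH d u) (p + R • q)) := by
        refine norm_integral_le_of_norm_le (hw2.add hF2) (Eventually.of_forall fun q => ?_)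
        rcases lt_or_ge (euclSq q) 1 with hq | hq
        · have hq' := hmem p (Metric.mem_ball_self (half_pos hR)) R ⟨hR.le, le_rfl⟩ q hq
          have hd : DifferentiableAt ℝ u (p + R • q) :=
            (hu.1.contDiffAt (hΩ.mem_nhds (hsub hq'))).differentiableAt (by norm_num)
          rw [(hev _ hq').fderiv_eq, norm_smul, Real.norm_of_nonneg (radialWeight_nonneg q),
            indicator_of_mem (hsub hq')]
          have := norm_fderiv_sq_le hd
          nlinarith [sq_nonneg (radialWeight q - ‖fderiv ℝ u (p + R • q)‖),
            sq_nonneg (radialWeight q)]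
        · rw [radialWeight_eq_zero hq]
          simpa using indicator_nonneg (fun x _ => gradSqH_nonneg u x) _
    _ = _ := by rw [integral_add hw2 hF2, hval]

theorem closedBall_subset_upBall {p : Esp d × ℝ} (hp : p ∈ upBall d (4 / 5)) :
    Metric.closedBall p (2 * (p.2 / 32)) ⊆ upBall d 1 := by
  obtain ⟨h1, h2⟩ := hp
  intro q hq
  rw [Metric.mem_closedBall, dist_eq_norm] at hq
  have ha : ‖q.1 - p.1‖ ≤ p.2 / 16 := (norm_fst_le (q - p)).trans (by linarith)
  have hb : |q.2 - p.2| ≤ p.2 / 16 := (norm_snd_le (q - p)).trans (by linarith)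
  have hx : ‖q.1‖ ≤ ‖p.1‖ + p.2 / 16 := by
    have := norm_add_le p.1 (q.1 - p.1)
    rw [add_sub_cancel] at this
    linarith
  obtain ⟨hb1, hb2⟩ := abs_le.1 hb
  have hp1 : ‖p.1‖ ≤ 4 / 5 := by nlinarith [norm_nonneg p.1]
  have hp2 : p.2 ≤ 4 / 5 := by nlinarith [norm_nonneg p.1]
  refine ⟨?_, by linarith⟩
  have e1 : ‖q.1‖ ^ 2 ≤ (‖p.1‖ + p.2 / 16) ^ 2 := by gcongr
  have e2 : q.2 ^ 2 ≤ (p.2 + p.2 / 16) ^ 2 := by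
    apply pow_le_pow_left₀ <;> linarith
  nlinarith [norm_nonneg p.1, mul_nonneg (sub_nonneg.2 hp1) h2.le,
    mul_nonneg (sub_nonneg.2 hp2) h2.le]

/-- Interior gradient bound for harmonic functions of finite energy in the half ball. -/
theorem exists_norm_fderiv_le (d : ℕ) (A : ℝ) : ∃ C > 0, ∀ u : Esp d × ℝ → ℝ,
    HarmonicOnH d u (upBall d 1) → IntegrableOn (gradSqH d u) (upBall d 1) →
    (∫ q in upBall d 1, gradSqH d u q) ≤ A ^ 2 →
    ∀ p ∈ upBall d (4 / 5), ‖fderiv ℝ u p‖ ≤ C * (p.2 ^ (d + 1))⁻¹ := by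
  have hm := integral_radialWeight_pos (d := d)
  set m := ∫ q : Esp d × ℝ, radialWeight q
  set n := ∫ q : Esp d × ℝ, radialWeight q ^ 2 with hn
  have hn0 : 0 ≤ n := integral_nonneg fun q => by positivity
  refine ⟨(n + 32 ^ (d + 1) * A ^ 2 + 1) / m, by positivity, fun u hu hint hA p hp => ?_⟩
  have hy : 0 < p.2 := hp.2
  have hy1 : p.2 ≤ 1 := by nlinarith [hp.1, norm_nonneg p.1]
  have h := norm_fderiv_le_of_closedBall_subset (isOpen_upBall d 1) hu hint
    (R := p.2 / 32) (by positivity) (closedBall_subset_upBall hp)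
  have hk : 1 ≤ (p.2 ^ (d + 1))⁻¹ := by
    rw [one_le_inv₀ (by positivity)]
    exact pow_le_one₀ hy.le hy1
  have h2 : ((p.2 / 32) ^ (d + 1))⁻¹ = 32 ^ (d + 1) * (p.2 ^ (d + 1))⁻¹ := by
    rw [div_pow, inv_div, div_eq_mul_inv]
  rw [h2] at h
  rw [div_mul_eq_mul_div, le_div_iff₀ hm, mul_comm]
  refine h.trans ?_
  have h3 : 32 ^ (d + 1) * (p.2 ^ (d + 1))⁻¹ * ∫ q in upBall d 1, gradSqH d u q ≤
      32 ^ (d + 1) * (p.2 ^ (d + 1))⁻¹ * A ^ 2 := by gcongr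
  nlinarith

end GradientBound

section Comparison

variable {d : ℕ}

theorem lineDeriv2_eq_of_hasDerivAt {E : Type*} [NormedAddCommGroup E] [NormedSpace ℝ E]
    {u : E → ℝ} {p v : E} {f' : ℝ → ℝ} {c : ℝ}
    (h : ∀ᶠ t in 𝓝 (0 : ℝ), HasDerivAt (fun t : ℝ => u (p + t • v)) (f' t) t)
    (h' : HasDerivAt f' c 0) : lineDeriv2 u p v = c := by
  have : deriv (fun t : ℝ => u (p + t • v)) =ᶠ[𝓝 0] f' := by
    filter_upwards [h] with t ht using ht.deriv
  rw [lineDeriv2, this.deriv_eq, h'.deriv]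

/-- Every `C²` strict supersolution `b`, with vanishing vertical derivative if `p` lies on
`{y = 0}`, fails to touch `g` from above at `p` relative to `{y ≥ 0}`. -/
def StrictSubAt (g : Esp d × ℝ → ℝ) (p : Esp d × ℝ) : Prop :=
  ∀ b : Esp d × ℝ → ℝ, ContDiffAt ℝ 2 b p → lapH d b p < 0 → (0 < p.2 ∨ pdy d b p = 0) →
    ¬ IsLocalMaxOn (fun q => g q - b q) {q | 0 ≤ q.2} p

/-- The quantity `(3/4)² - |x|²`. -/
noncomputable def gap (x : Esp d) : ℝ := 9 / 16 - ‖x‖ ^ 2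

theorem continuous_gap : Continuous (gap (d := d)) := by unfold gap; fun_prop

/-- A supersolution that blows up on `{|x| = 3/4}`. -/
noncomputable def singularBarrier (k : ℕ) (M : ℝ) (p : Esp d × ℝ) : ℝ :=
  (gap p.1)⁻¹ ^ k - (M * p.2) ^ 2 * (gap p.1)⁻¹ ^ (k + 2)

theorem contDiffAt_singularBarrier (k : ℕ) (M : ℝ) {p : Esp d × ℝ} (hp : 0 < gap p.1) :
    ContDiffAt ℝ 2 (singularBarrier k M) p := by
  have h1 : ContDiffAt ℝ 2 (fun q : Esp d × ℝ => gap q.1) p := by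
    unfold gap
    exact contDiffAt_const.sub (contDiffAt_fst.norm_sq ℝ)
  have h2 : ContDiffAt ℝ 2 (fun q : Esp d × ℝ => (gap q.1)⁻¹) p := h1.inv hp.ne'
  have h3 : ContDiffAt ℝ 2 (fun q : Esp d × ℝ => (M * q.2) ^ 2) p :=
    (contDiffAt_const.mul contDiffAt_snd).pow 2
  exact (h2.pow k).sub (h3.mul (h2.pow (k + 2)))

theorem hasDerivAt_gap_inv_pow (x : Esp d) (i : Fin d) (m : ℕ) {t : ℝ}
    (ht : gap (x + t • EuclideanSpace.single i (1 : ℝ)) ≠ 0) :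
    HasDerivAt (fun t : ℝ => (gap (x + t • EuclideanSpace.single i (1 : ℝ)))⁻¹ ^ m)
      (m * (gap (x + t • EuclideanSpace.single i (1 : ℝ)))⁻¹ ^ (m + 1) * (2 * x i + 2 * t)) t := by
  have h1 : HasDerivAt (fun t : ℝ => gap (x + t • EuclideanSpace.single i (1 : ℝ)))
      (-(2 * x i + 2 * t)) t := by
    simp only [gap, norm_sq_add_smul_single]
    have h := (((hasDerivAt_id t).const_mul (2 * x i)).const_add (‖x‖ ^ 2)).add
      (hasDerivAt_pow 2 t) |>.const_sub (9 / 16)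
    simpa using h
  have h2 := (h1.fun_inv ht).fun_pow m
  refine h2.congr_deriv ?_
  rcases m with _ | m
  · simp
  · rw [Nat.add_sub_cancel, neg_neg, div_eq_mul_inv, ← inv_pow]
    ring

theorem lapH_singularBarrier (k : ℕ) (M : ℝ) {p : Esp d × ℝ} (hp : 0 < gap p.1) :
    lapH d (singularBarrier k M) p =
      ∑ i, (k * (k + 1) * (gap p.1)⁻¹ ^ (k + 2) * (2 * p.1 i) ^ 2 + 2 * k * (gap p.1)⁻¹ ^ (k + 1)
        - (M * p.2) ^ 2 * ((k + 2) * (k + 3) * (gap p.1)⁻¹ ^ (k + 4) * (2 * p.1 i) ^ 2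
          + 2 * (k + 2) * (gap p.1)⁻¹ ^ (k + 3)))
      - 2 * M ^ 2 * (gap p.1)⁻¹ ^ (k + 2) := by
  rw [lapH_eq_sum, Fintype.sum_option, add_comm, sub_eq_add_neg]
  congr 1
  · refine Finset.sum_congr rfl fun i _ => ?_
    have hg : Continuous fun t : ℝ => gap (p.1 + t • EuclideanSpace.single i (1 : ℝ)) := by
      have := continuous_gap (d := d); fun_prop
    have hpos : ∀ᶠ t in 𝓝 (0 : ℝ), 0 < gap (p.1 + t • EuclideanSpace.single i (1 : ℝ)) :=
      hg.continuousAt.eventually (lt_mem_nhds (by simpa using hp))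
    have hslice : (fun t : ℝ => singularBarrier k M (p + t • coordDir d (some i))) = fun t : ℝ =>
        (gap (p.1 + t • EuclideanSpace.single i (1 : ℝ)))⁻¹ ^ k - (M * p.2) ^ 2 *
          (gap (p.1 + t • EuclideanSpace.single i (1 : ℝ)))⁻¹ ^ (k + 2) := by
      ext t
      simp [singularBarrier, coordDir]
    have h2 : ∀ m : ℕ, HasDerivAt (fun t : ℝ =>
        m * (gap (p.1 + t • EuclideanSpace.single i (1 : ℝ)))⁻¹ ^ (m + 1) * (2 * p.1 i + 2 * t))
        (m * (m + 1) * (gap p.1)⁻¹ ^ (m + 2) * (2 * p.1 i) ^ 2 + 2 * m * (gap p.1)⁻¹ ^ (m + 1))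
        0 := by
      intro m
      have ha := hasDerivAt_gap_inv_pow p.1 i (m + 1) (t := 0) (by simpa using hp.ne')
      have hb : HasDerivAt (fun t : ℝ => 2 * p.1 i + 2 * t) 2 0 := by
        simpa using ((hasDerivAt_id (0 : ℝ)).const_mul 2).const_add (2 * p.1 i)
      have := (ha.const_mul (m : ℝ)).mul hb
      refine this.congr_deriv ?_
      simp only [zero_smul, add_zero, mul_zero]
      push_cast
      ring
    refine lineDeriv2_eq_of_hasDerivAt (f' := fun t : ℝ =>
      k * (gap (p.1 + t • EuclideanSpace.single i (1 : ℝ)))⁻¹ ^ (k + 1) * (2 * p.1 i + 2 * t)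
      - (M * p.2) ^ 2 * (((k + 2 : ℕ) : ℝ) *
        (gap (p.1 + t • EuclideanSpace.single i (1 : ℝ)))⁻¹ ^ (k + 2 + 1) * (2 * p.1 i + 2 * t)))
      ?_ ?_
    · rw [hslice]
      filter_upwards [hpos] with t ht
      exact (hasDerivAt_gap_inv_pow p.1 i k ht.ne').sub
        ((hasDerivAt_gap_inv_pow p.1 i (k + 2) ht.ne').const_mul _)
    · refine ((h2 k).sub ((h2 (k + 2)).const_mul ((M * p.2) ^ 2))).congr_deriv ?_
      push_cast
      ring
  · refine lineDeriv2_eq_of_hasDerivAt (f' := fun t : ℝ =>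
      -(2 * M ^ 2 * (p.2 + t) * (gap p.1)⁻¹ ^ (k + 2))) (Eventually.of_forall fun t => ?_) ?_
    · have hslice : (fun t : ℝ => singularBarrier k M (p + t • coordDir d none)) = fun t : ℝ =>
          (gap p.1)⁻¹ ^ k - (M * (p.2 + t)) ^ 2 * (gap p.1)⁻¹ ^ (k + 2) := by
        ext t
        simp [singularBarrier, coordDir]
      rw [hslice]
      have h1 : HasDerivAt (fun t : ℝ => M * (p.2 + t)) M t := by
        simpa using ((hasDerivAt_id t).const_add p.2).const_mul M
      refine (((h1.fun_pow 2).mul_const ((gap p.1)⁻¹ ^ (k + 2))).const_sub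
        ((gap p.1)⁻¹ ^ k)).congr_deriv ?_
      push_cast
      ring
    · have h1 : HasDerivAt (fun t : ℝ => p.2 + t) 1 0 := (hasDerivAt_id _).const_add p.2
      refine ((h1.const_mul (2 * M ^ 2)).mul_const ((gap p.1)⁻¹ ^ (k + 2))).neg.congr_deriv ?_
      ring

theorem lapH_singularBarrier_neg (k : ℕ) {M : ℝ} (hM : M = 2 * k + d + 4) {p : Esp d × ℝ}
    (hp : 0 < gap p.1) : lapH d (singularBarrier k M) p < 0 := by
  rw [lapH_singularBarrier k M hp]
  have hx : ‖p.1‖ ^ 2 ≤ 9 / 16 := by unfold gap at hp; linarith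
  have hv : 1 ≤ (gap p.1)⁻¹ := by
    rw [one_le_inv₀ hp]; unfold gap; nlinarith [norm_nonneg p.1]
  set v := (gap p.1)⁻¹
  have hv0 : 0 < v := by linarith
  have hv2 : v ^ (k + 1) ≤ v ^ (k + 2) := pow_le_pow_right₀ hv (by lia)
  have hv3 : 0 < v ^ (k + 2) := by positivity
  have hsum : ∑ i, (k * (k + 1) * v ^ (k + 2) * (2 * p.1 i) ^ 2 + 2 * k * v ^ (k + 1)
        - (M * p.2) ^ 2 * ((k + 2) * (k + 3) * v ^ (k + 4) * (2 * p.1 i) ^ 2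
          + 2 * (k + 2) * v ^ (k + 3))) ≤
      ∑ i, (4 * k * (k + 1) * v ^ (k + 2) * (p.1 i) ^ 2 + 2 * k * v ^ (k + 2)) := by
    refine Finset.sum_le_sum fun i _ => ?_
    have h1 : 0 ≤ (M * p.2) ^ 2 * ((k + 2) * (k + 3) * v ^ (k + 4) * (2 * p.1 i) ^ 2
          + 2 * (k + 2) * v ^ (k + 3)) := by positivity
    have h2 : 2 * k * v ^ (k + 1) ≤ 2 * k * v ^ (k + 2) := by gcongr
    nlinarith
  have hnorm : ∑ i, (p.1 i) ^ 2 = ‖p.1‖ ^ 2 := by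
    rw [EuclideanSpace.norm_sq_eq]
    simp
  rw [Finset.sum_add_distrib, ← Finset.mul_sum, hnorm, Finset.sum_const, Finset.card_univ,
    Fintype.card_fin, nsmul_eq_mul] at hsum
  have h4 : 4 * (k : ℝ) * (k + 1) * v ^ (k + 2) * ‖p.1‖ ^ 2 ≤ 4 * k * (k + 1) * v ^ (k + 2) * 1 := by
    gcongr
    linarith
  have h5 : 4 * (k : ℝ) * (k + 1) + 2 * k * d < 2 * M ^ 2 := by
    rw [hM]
    have : (0 : ℝ) ≤ k := by positivity
    have : (0 : ℝ) ≤ d := by positivity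
    nlinarith [mul_nonneg (Nat.cast_nonneg (α := ℝ) k) (Nat.cast_nonneg (α := ℝ) d)]
  nlinarith [mul_lt_mul_of_pos_right h5 hv3]

theorem pdy_const_mul_singularBarrier (k : ℕ) (M C : ℝ) {p : Esp d × ℝ} (hp : p.2 = 0) :
    pdy d (fun q => C * singularBarrier k M q) p = 0 := by
  unfold pdy
  refine HasDerivAt.deriv ?_
  simp only [singularBarrier, hp, zero_add]
  have h1 : HasDerivAt (fun t : ℝ => M * t) M 0 := by
    simpa using (hasDerivAt_id (0 : ℝ)).const_mul M
  have := (((h1.fun_pow 2).mul_const ((gap p.1)⁻¹ ^ (k + 2))).const_sub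
    ((gap p.1)⁻¹ ^ k)).const_mul C
  simpa using this

theorem singularBarrier_ge (k : ℕ) {M : ℝ} (hM : 0 ≤ M) {p : Esp d × ℝ} (hp : 0 < gap p.1)
    (h0 : 0 ≤ p.2) (h : 2 * M * p.2 ≤ gap p.1) :
    3 / 4 * (gap p.1)⁻¹ ^ k ≤ singularBarrier k M p := by
  have h1 : M * p.2 * (gap p.1)⁻¹ ≤ 1 / 2 := by
    rw [← div_eq_mul_inv, div_le_iff₀ hp]
    linarith
  have h2 : (M * p.2 * (gap p.1)⁻¹) ^ 2 ≤ 1 / 4 := by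
    have : 0 ≤ M * p.2 * (gap p.1)⁻¹ := by positivity
    nlinarith
  have h3 : singularBarrier k M p =
      (gap p.1)⁻¹ ^ k * (1 - (M * p.2 * (gap p.1)⁻¹) ^ 2) := by
    unfold singularBarrier; ring
  have h4 : 0 < (gap p.1)⁻¹ ^ k := by positivity
  rw [h3]
  nlinarith

theorem singularBarrier_le (k : ℕ) (M : ℝ) {p : Esp d × ℝ} (hp : 0 < gap p.1) :
    singularBarrier k M p ≤ (gap p.1)⁻¹ ^ k := by
  have : 0 ≤ (M * p.2) ^ 2 * (gap p.1)⁻¹ ^ (k + 2) := by positivity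
  unfold singularBarrier
  linarith

/-- The region below the graph of `gap / (2 M)`, truncated at `gap = δ`. -/
def barrierRegion (d : ℕ) (M δ : ℝ) : Set (Esp d × ℝ) :=
  {p | 0 ≤ p.2 ∧ δ ≤ gap p.1 ∧ 2 * M * p.2 ≤ gap p.1}

theorem norm_le_of_gap_nonneg {x : Esp d} (h : 0 ≤ gap x) : ‖x‖ ≤ 3 / 4 := by
  unfold gap at h
  nlinarith [norm_nonneg x]

theorem snd_le_of_mem_barrierRegion {M : ℝ} (hM : 4 ≤ M) {p : Esp d × ℝ}
    (hp : p ∈ barrierRegion d M 0) : p.2 ≤ 9 / 128 := by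
  have h1 : gap p.1 ≤ 9 / 16 := by unfold gap; nlinarith [norm_nonneg p.1]
  have h2 := mul_le_mul_of_nonneg_right hM hp.1
  linarith [hp.2.2]

theorem isCompact_barrierRegion {M δ : ℝ} (hM : 4 ≤ M) (hδ : 0 ≤ δ) :
    IsCompact (barrierRegion d M δ) := by
  have hg := continuous_gap (d := d)
  have hsub : barrierRegion d M δ ⊆ Metric.closedBall (0 : Esp d) (3 / 4) ×ˢ Icc (0 : ℝ) (9 / 128) := by
    intro p hp
    have hp' : p ∈ barrierRegion d M 0 := ⟨hp.1, hδ.trans hp.2.1, hp.2.2⟩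
    exact ⟨by simpa using norm_le_of_gap_nonneg hp'.2.1, hp.1, snd_le_of_mem_barrierRegion hM hp'⟩
  refine ((isCompact_closedBall _ _).prod isCompact_Icc).of_isClosed_subset ?_ hsub
  have h1 : IsClosed {p : Esp d × ℝ | 0 ≤ p.2} := isClosed_le (by fun_prop) (by fun_prop)
  have h2 : IsClosed {p : Esp d × ℝ | δ ≤ gap p.1} := isClosed_le (by fun_prop) (by fun_prop)
  have h3 : IsClosed {p : Esp d × ℝ | 2 * M * p.2 ≤ gap p.1} :=
    isClosed_le (by fun_prop) (by fun_prop)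
  exact h1.inter (h2.inter h3)

/-- A strict subsolution that is at most `C₀ y^{-k}` on the graph `y = gap / (2 M)` is bounded
below it by a multiple of `gap^{-k}`. -/
theorem le_of_strictSubAt_of_le_top {k : ℕ} (hk : 1 ≤ k) {M C₀ : ℝ} (hM : M = 2 * k + d + 4)
    (hC₀ : 0 < C₀) {g : Esp d × ℝ → ℝ} (hcont : ContinuousOn g (barrierRegion d M 0))
    (htop : ∀ p : Esp d × ℝ, 0 < p.2 → 2 * M * p.2 = gap p.1 → g p ≤ C₀ * (p.2 ^ k)⁻¹)
    (hsub : ∀ p ∈ barrierRegion d M 0, 0 < gap p.1 → 2 * M * p.2 < gap p.1 → 0 < g p →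
      StrictSubAt g p)
    {p : Esp d × ℝ} (hp : p ∈ barrierRegion d M 0) (hgap : 0 < gap p.1) :
    g p ≤ 4 / 3 * C₀ * (2 * M) ^ k * (gap p.1)⁻¹ ^ k := by
  have hM4 : 4 ≤ M := by
    rw [hM]
    have : (0 : ℝ) ≤ k := by positivity
    have : (0 : ℝ) ≤ d := by positivity
    linarith
  have hM0 : 0 < M := by linarith
  set C₁ := 4 / 3 * C₀ * (2 * M) ^ k with hC₁
  have hC₁0 : 0 < C₁ := by positivity
  obtain ⟨N, hN⟩ := (isCompact_barrierRegion hM4 le_rfl).exists_bound_of_continuousOn hcont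
  have hN0 : 0 ≤ N := (norm_nonneg _).trans (hN p hp)
  set δ := min (gap p.1) (C₁ * (3 / 4) / (N + 1)) with hδ
  have hδ0 : 0 < δ := lt_min hgap (by positivity)
  have hδ1 : δ ≤ 1 := (min_le_left _ _).trans (by unfold gap; nlinarith [norm_nonneg p.1])
  have hδN : N < C₁ * (3 / 4 * δ⁻¹ ^ k) := by
    have h1 : δ⁻¹ ≤ δ⁻¹ ^ k := le_self_pow₀ ((one_le_inv₀ hδ0).2 hδ1) (by lia)
    have h2 : N + 1 ≤ C₁ * (3 / 4) * δ⁻¹ := by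
      rw [← div_eq_mul_inv, le_div_iff₀ hδ0, mul_comm, ← le_div_iff₀ (by positivity)]
      exact min_le_right _ _
    have h3 : C₁ * (3 / 4) * δ⁻¹ ≤ C₁ * (3 / 4) * δ⁻¹ ^ k := by gcongr
    linarith
  have hsubset : barrierRegion d M δ ⊆ barrierRegion d M 0 := fun q hq =>
    ⟨hq.1, hδ0.le.trans hq.2.1, hq.2.2⟩
  have hpδ : p ∈ barrierRegion d M δ := ⟨hp.1, min_le_left _ _, hp.2.2⟩
  have hbcont : ContinuousOn (fun q => g q - C₁ * singularBarrier k M q) (barrierRegion d M δ) := by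
    refine (hcont.mono hsubset).sub (continuousOn_const.mul fun q hq => ?_)
    exact (contDiffAt_singularBarrier k M (hδ0.trans_le hq.2.1)).continuousAt.continuousWithinAt
  obtain ⟨q, hq, hmax⟩ := (isCompact_barrierRegion hM4 hδ0.le).exists_isMaxOn ⟨p, hpδ⟩ hbcont
  have hgq : 0 < gap q.1 := hδ0.trans_le hq.2.1
  have hbq := singularBarrier_ge k hM0.le hgq hq.1 hq.2.2
  have hbq' := mul_le_mul_of_nonneg_left hbq hC₁0.le
  suffices hle : g q - C₁ * singularBarrier k M q ≤ 0 by
    have h1 : g p - C₁ * singularBarrier k M p ≤ g q - C₁ * singularBarrier k M q := hmax hpδ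
    have h2 := mul_le_mul_of_nonneg_left (singularBarrier_le k M hgap) hC₁0.le
    linarith
  by_contra! hpos
  rcases hq.2.1.eq_or_lt with hs | hs
  · have h1 := (le_abs_self _).trans (hN q (hsubset hq))
    rw [← hs] at hbq'
    linarith
  rcases hq.2.2.eq_or_lt with ht | ht
  · have hq2 : 0 < q.2 := by
      by_contra! hle
      nlinarith
    have h1 := htop q hq2 ht
    have h2 : C₁ * (3 / 4 * (gap q.1)⁻¹ ^ k) = C₀ * (q.2 ^ k)⁻¹ := by
      rw [← ht, hC₁, inv_pow, mul_pow (2 * M)]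
      field_simp
    linarith
  have hgpos : 0 < g q := by
    have : 0 < C₁ * (3 / 4 * (gap q.1)⁻¹ ^ k) := by positivity
    linarith
  refine hsub q (hsubset hq) hgq ht hgpos (fun q => C₁ * singularBarrier k M q)
    (contDiffAt_const.mul (contDiffAt_singularBarrier k M hgq)) ?_ ?_ ?_
  · rw [lapH_const_mul _ (contDiffAt_singularBarrier k M hgq)]
    exact mul_neg_of_pos_of_neg hC₁0 (lapH_singularBarrier_neg k hM hgq)
  · rcases hq.1.eq_or_lt with h | h
    · exact Or.inr (pdy_const_mul_singularBarrier k M C₁ h.symm)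
    · exact Or.inl h
  · have hg := continuous_gap (d := d)
    have e1 : ∀ᶠ z in 𝓝 q, δ < gap z.1 :=
      (show Continuous fun z : Esp d × ℝ => gap z.1 by fun_prop).continuousAt.eventually
        (lt_mem_nhds hs)
    have e2 : ∀ᶠ z in 𝓝 q, 2 * M * z.2 < gap z.1 :=
      (isOpen_lt (f := fun z : Esp d × ℝ => 2 * M * z.2) (g := fun z => gap z.1)
        (by fun_prop) (by fun_prop)).mem_nhds ht
    filter_upwards [mem_nhdsWithin_of_mem_nhds e1, mem_nhdsWithin_of_mem_nhds e2,
      self_mem_nhdsWithin] with z h1 h2 h3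
    exact hmax ⟨h3, h1.le, h2.le⟩

/-- The function `|x - x₀|² + (d + 2) ρ y - (d + 1) y²`. -/
noncomputable def linearBarrier (x₀ : Esp d) (ρ : ℝ) (p : Esp d × ℝ) : ℝ :=
  ‖p.1 - x₀‖ ^ 2 + (d + 2) * ρ * p.2 - (d + 1) * p.2 ^ 2

theorem contDiff_linearBarrier (x₀ : Esp d) (ρ : ℝ) : ContDiff ℝ 2 (linearBarrier x₀ ρ) := by
  unfold linearBarrier
  exact (((contDiff_fst.sub contDiff_const).norm_sq ℝ).add
    (contDiff_const.mul contDiff_snd)).sub (contDiff_const.mul (contDiff_snd.pow 2))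

theorem lapH_linearBarrier (x₀ : Esp d) (ρ : ℝ) (p : Esp d × ℝ) :
    lapH d (linearBarrier x₀ ρ) p = -2 := by
  rw [lapH_eq_sum, Fintype.sum_option]
  have h1 : ∀ i : Fin d, lineDeriv2 (linearBarrier x₀ ρ) p (coordDir d (some i)) = 2 := by
    intro i
    have hslice : (fun t : ℝ => linearBarrier x₀ ρ (p + t • coordDir d (some i))) = fun t : ℝ =>
        ‖p.1 - x₀‖ ^ 2 + 2 * (p.1 - x₀) i * t + t ^ 2 + (d + 2) * ρ * p.2 - (d + 1) * p.2 ^ 2 := by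
      ext t
      rw [← norm_sq_add_smul_single]
      simp [linearBarrier, coordDir, add_sub_right_comm]
    refine lineDeriv2_eq_of_hasDerivAt (f' := fun t : ℝ => 2 * (p.1 - x₀) i + 2 * t)
      (Eventually.of_forall fun t => ?_) ?_
    · rw [hslice]
      have h := ((((hasDerivAt_id t).const_mul (2 * (p.1 - x₀) i)).const_add (‖p.1 - x₀‖ ^ 2)).add
        (hasDerivAt_pow 2 t)).add_const ((d + 2) * ρ * p.2) |>.sub_const ((d + 1) * p.2 ^ 2)
      simpa using h
    · simpa using ((hasDerivAt_id (0 : ℝ)).const_mul 2).const_add (2 * (p.1 - x₀) i)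
  have h2 : lineDeriv2 (linearBarrier x₀ ρ) p (coordDir d none) = -(2 * (d + 1)) := by
    have hslice : (fun t : ℝ => linearBarrier x₀ ρ (p + t • coordDir d none)) = fun t : ℝ =>
        ‖p.1 - x₀‖ ^ 2 + (d + 2) * ρ * (p.2 + t) - (d + 1) * (p.2 + t) ^ 2 := by
      ext t
      simp [linearBarrier, coordDir]
    refine lineDeriv2_eq_of_hasDerivAt
      (f' := fun t : ℝ => (d + 2) * ρ - (d + 1) * (2 * (p.2 + t)))
      (Eventually.of_forall fun t => ?_) ?_
    · rw [hslice]
      have h0 : HasDerivAt (fun t : ℝ => p.2 + t) 1 t := (hasDerivAt_id t).const_add p.2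
      have h := ((h0.const_mul (((d : ℝ) + 2) * ρ)).const_add (‖p.1 - x₀‖ ^ 2)).fun_sub
        ((h0.fun_pow 2).const_mul ((d : ℝ) + 1))
      simpa using h
    · have h0 : HasDerivAt (fun t : ℝ => p.2 + t) 1 0 := (hasDerivAt_id _).const_add p.2
      have h := ((h0.const_mul 2).const_mul ((d : ℝ) + 1)).const_sub (((d : ℝ) + 2) * ρ)
      exact h.congr_deriv (by ring)
  simp only [h1, h2, Finset.sum_const, Finset.card_univ, Fintype.card_fin, nsmul_eq_mul]
  ring

/-- A bounded strict subsolution that is nonpositive on `{y = 0}` grows at most linearly. -/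
theorem le_linear_of_strictSubAt {x₀ : Esp d} {ρ N : ℝ} (hρ : 0 < ρ) (hN : 0 < N)
    {g : Esp d × ℝ → ℝ} (hcont : ContinuousOn g (Metric.closedBall x₀ ρ ×ˢ Icc 0 ρ))
    (hbound : ∀ p ∈ Metric.closedBall x₀ ρ ×ˢ Icc 0 ρ, g p ≤ N)
    (hzero : ∀ x ∈ Metric.closedBall x₀ ρ, g (x, 0) ≤ 0)
    (hsub : ∀ p ∈ Metric.closedBall x₀ ρ ×ˢ Icc 0 ρ, 0 < p.2 → StrictSubAt g p)
    {y : ℝ} (hy : y ∈ Icc 0 ρ) : g (x₀, y) ≤ N * (d + 2) / ρ * y := by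
  set c := N / ρ ^ 2 with hc
  have hc0 : 0 < c := by positivity
  have hd0 : (0 : ℝ) ≤ d := by positivity
  have hmem : (x₀, y) ∈ Metric.closedBall x₀ ρ ×ˢ Icc 0 ρ :=
    ⟨Metric.mem_closedBall_self hρ.le, hy⟩
  have hb := contDiff_linearBarrier x₀ ρ
  obtain ⟨q, hq, hmax⟩ := ((isCompact_closedBall x₀ ρ).prod
    (isCompact_Icc (a := 0) (b := ρ))).exists_isMaxOn ⟨_, hmem⟩
    (hcont.sub (continuousOn_const (c := c) |>.mul hb.continuous.continuousOn))
  have hcN : c * ρ ^ 2 = N := by rw [hc]; field_simp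
  suffices hle : g q - c * linearBarrier x₀ ρ q ≤ 0 by
    have h1 : g (x₀, y) - c * linearBarrier x₀ ρ (x₀, y) ≤ g q - c * linearBarrier x₀ ρ q :=
      hmax hmem
    have h2 : linearBarrier x₀ ρ (x₀, y) ≤ (d + 2) * ρ * y := by
      simp only [linearBarrier, sub_self, norm_zero]
      nlinarith [sq_nonneg y]
    have h3 := mul_le_mul_of_nonneg_left h2 hc0.le
    have h4 : c * ((d + 2) * ρ * y) = N * (d + 2) / ρ * y := by rw [hc]; field_simp
    linarith
  by_contra! hpos
  obtain ⟨hq1, hq2, hq3⟩ := hq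
  rw [Metric.mem_closedBall, dist_eq_norm] at hq1
  have hpart : ρ * q.2 ≤ (d + 2) * ρ * q.2 - (d + 1) * q.2 ^ 2 := by
    have := mul_nonneg (mul_nonneg (show (0 : ℝ) ≤ d + 1 by positivity) hq2) (sub_nonneg.2 hq3)
    nlinarith
  have hge : ‖q.1 - x₀‖ ^ 2 + ρ * q.2 ≤ linearBarrier x₀ ρ q := by
    unfold linearBarrier; linarith
  have hρq : 0 ≤ ρ * q.2 := mul_nonneg hρ.le hq2
  have hge' := mul_le_mul_of_nonneg_left hge hc0.le
  have hgN := hbound q ⟨by rwa [Metric.mem_closedBall, dist_eq_norm], hq2, hq3⟩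
  rcases hq2.eq_or_lt with h0 | h0
  · have h1 := hzero q.1 (by rwa [Metric.mem_closedBall, dist_eq_norm])
    have h2 : (q.1, (0 : ℝ)) = q := by rw [h0]
    rw [h2] at h1
    have : 0 ≤ c * (‖q.1 - x₀‖ ^ 2 + ρ * q.2) := by positivity
    linarith
  rcases hq3.eq_or_lt with h3 | h3
  · rw [h3] at hge'
    have : c * ρ ^ 2 ≤ c * (‖q.1 - x₀‖ ^ 2 + ρ * ρ) := by
      gcongr; nlinarith [sq_nonneg ‖q.1 - x₀‖]
    linarith
  rcases hq1.eq_or_lt with h4 | h4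
  · rw [h4] at hge'
    have : c * ρ ^ 2 ≤ c * (ρ ^ 2 + ρ * q.2) := by gcongr; linarith
    linarith
  refine hsub q ⟨by simpa [dist_eq_norm] using hq1, hq2, h3.le⟩ h0
    (fun q => c * linearBarrier x₀ ρ q) (contDiffAt_const.mul hb.contDiffAt) ?_ (Or.inl h0) ?_
  · rw [lapH_const_mul _ hb.contDiffAt, lapH_linearBarrier]
    linarith
  · have e1 : ∀ᶠ z in 𝓝 q, ‖z.1 - x₀‖ < ρ :=
      (show Continuous fun z : Esp d × ℝ => ‖z.1 - x₀‖ by fun_prop).continuousAt.eventually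
        (gt_mem_nhds h4)
    have e2 : ∀ᶠ z in 𝓝 q, z.2 < ρ := continuous_snd.continuousAt.eventually (gt_mem_nhds h3)
    filter_upwards [mem_nhdsWithin_of_mem_nhds e1, mem_nhdsWithin_of_mem_nhds e2,
      self_mem_nhdsWithin] with z h1 h2 h3
    exact hmax ⟨by simpa [dist_eq_norm] using h1.le, h3, h2.le⟩

end Comparison

section Touching

variable {d : ℕ}

theorem IsLocalMaxOn.eventually_vertical {G : Esp d × ℝ → ℝ} {p : Esp d × ℝ} (hp : 0 ≤ p.2)
    (h : IsLocalMaxOn G {q | 0 ≤ q.2} p) : ∀ᶠ t in 𝓝[>] (0 : ℝ), G (p.1, p.2 + t) ≤ G p := by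
  have hc : ContinuousAt (fun t : ℝ => (p.1, p.2 + t)) 0 := by fun_prop
  have ht : Tendsto (fun t : ℝ => (p.1, p.2 + t)) (𝓝[>] 0) (𝓝[{q | 0 ≤ q.2}] p) := by
    refine tendsto_nhdsWithin_iff.2 ⟨?_, ?_⟩
    · simpa [ContinuousAt] using hc.tendsto.mono_left nhdsWithin_le_nhds
    · filter_upwards [self_mem_nhdsWithin] with t ht
      exact add_nonneg hp (le_of_lt ht)
  exact ht.eventually h

theorem IsLocalMaxOn.isLocalMax_of_pos {G : Esp d × ℝ → ℝ} {p : Esp d × ℝ} (hp : 0 < p.2)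
    (h : IsLocalMaxOn G {q | 0 ≤ q.2} p) : IsLocalMax G p :=
  h.isLocalMax (mem_of_superset
    ((isOpen_lt (continuous_const (y := (0 : ℝ))) continuous_snd).mem_nhds hp)
    fun q (hq : 0 < q.2) => hq.le)

theorem lapH_affine (a b : ℝ) (p : Esp d × ℝ) : lapH d (fun q => a + b * q.2) p = 0 := by
  have h : deriv (fun t : ℝ => a + b * (p.2 + t)) = fun _ => b := by
    ext t
    have h1 : HasDerivAt (fun t : ℝ => a + b * (p.2 + t)) (b * 1) t :=
      (((hasDerivAt_id t).const_add p.2).const_mul b).const_add a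
    rw [h1.deriv, mul_one]
  simp [lapH, h]

theorem contDiff_affine (a b : ℝ) : ContDiff ℝ 2 (fun q : Esp d × ℝ => a + b * q.2) :=
  contDiff_const.add (contDiff_const.mul contDiff_snd)

/-- The Laplacian commutes with vertical translations and reflections. -/
theorem lapH_comp_vertical (u : Esp d × ℝ → ℝ) {σ : ℝ} (hσ : σ * σ = 1) (s : ℝ) (p : Esp d × ℝ) :
    lapH d (fun q => u (q.1, σ * q.2 + s)) p = lapH d u (p.1, σ * p.2 + s) := by
  simp only [lapH]
  congr 1
  set F : ℝ → ℝ := fun r => u (p.1, σ * p.2 + s + r)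
  have h1 : (fun t : ℝ => u (p.1, σ * (p.2 + t) + s)) = fun t => F (σ * t) := by
    ext t
    simp only [F]
    congr 2
    ring
  have h2 : deriv (fun t : ℝ => u (p.1, σ * (p.2 + t) + s)) = fun t => σ * deriv F (σ * t) := by
    ext t
    rw [h1, deriv_comp_mul_left, smul_eq_mul]
  rw [h2, deriv_const_mul_field, deriv_comp_mul_left, smul_eq_mul, ← mul_assoc, hσ, one_mul,
    mul_zero]

theorem contDiffAt_comp_vertical {u : Esp d × ℝ → ℝ} {σ s : ℝ} {p : Esp d × ℝ}
    (h : ContDiffAt ℝ 2 u (p.1, σ * p.2 + s)) :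
    ContDiffAt ℝ 2 (fun q : Esp d × ℝ => u (q.1, σ * q.2 + s)) p := by
  have h1 : ContDiff ℝ 2 (fun q : Esp d × ℝ => (q.1, σ * q.2 + s)) :=
    contDiff_fst.prodMk ((contDiff_const.mul contDiff_snd).add contDiff_const)
  exact h.comp p (f := fun q : Esp d × ℝ => (q.1, σ * q.2 + s)) h1.contDiffAt

theorem strictSubAt_of_harmonic {g : Esp d × ℝ → ℝ} {p : Esp d × ℝ} (hp : 0 < p.2)
    (hg : ContDiffAt ℝ 2 g p) (h0 : lapH d g p = 0) : StrictSubAt g p := by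
  intro b hb hlap _ hmax
  have h := lapH_nonpos_of_isLocalMax (hmax.isLocalMax_of_pos hp) (hg.sub hb).continuousAt
  rw [lapH_sub hg hb, h0] at h
  linarith

theorem StrictSubAt.congr {g g' : Esp d × ℝ → ℝ} {p : Esp d × ℝ} (h : StrictSubAt g p)
    (hg : g =ᶠ[𝓝 p] g') : StrictSubAt g' p := by
  intro b hb hlap hy hmax
  refine h b hb hlap hy ?_
  filter_upwards [hmax, mem_nhdsWithin_of_mem_nhds hg] with q h1 h2
  rw [h2, hg.eq_of_nhds]
  exact h1

theorem hasDerivAt_vertical {u : Esp d × ℝ → ℝ} {p : Esp d × ℝ} (h : DifferentiableAt ℝ u p) :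
    HasDerivAt (fun t : ℝ => u (p.1, p.2 + t)) (pdy d u p) 0 := by
  have h1 := hasDerivAt_slice (u := u) (p := p) (v := (0, 1)) (t := 0) (by simpa using h)
  rw [pdy_eq_fderiv h]
  convert h1 using 1
  · ext t
    congr 1
    ext <;> simp
  · simp

end Touching

section NeumannSolutions

variable {d : ℕ}

/-- A harmonic function in `B₁⁺` whose one-sided normal derivative on `B₁'` exists and is bounded
by `θ`, with an interior gradient bound of constant `C`. -/
structure NeumannSol (d : ℕ) (θ C : ℝ) (u : Esp d × ℝ → ℝ) : Prop where
  continuousOn : ContinuousOn u (upBall d 1 ∪ flatBall d 1)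
  harmonic : HarmonicOnH d u (upBall d 1)
  normal : ∀ x : Esp d, ‖x‖ < 1 → ∃ L : ℝ, NormalDeriv d u x L ∧ |L| ≤ θ
  norm_fderiv_le : ∀ p ∈ upBall d (4 / 5), ‖fderiv ℝ u p‖ ≤ C * (p.2 ^ (d + 1))⁻¹

theorem mem_upBall_one {p : Esp d × ℝ} (h1 : ‖p.1‖ ≤ 3 / 4) (h2 : 0 < p.2) (h3 : p.2 ≤ 1 / 2) :
    p ∈ upBall d 1 :=
  ⟨by nlinarith [norm_nonneg p.1], h2⟩

theorem mem_upBall_union_flatBall {p : Esp d × ℝ} (h1 : ‖p.1‖ ≤ 3 / 4) (h2 : 0 ≤ p.2)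
    (h3 : p.2 ≤ 1 / 2) : p ∈ upBall d 1 ∪ flatBall d 1 := by
  rcases h2.eq_or_lt with h | h
  · exact Or.inr ⟨by nlinarith [norm_nonneg p.1], h.symm⟩
  · exact Or.inl (mem_upBall_one h1 h h3)

theorem HarmonicOnH.contDiffAt {u : Esp d × ℝ → ℝ} {r : ℝ} (h : HarmonicOnH d u (upBall d r))
    {p : Esp d × ℝ} (hp : p ∈ upBall d r) : ContDiffAt ℝ 2 u p :=
  h.1.contDiffAt ((isOpen_upBall d r).mem_nhds hp)

namespace NeumannSol

variable {θ C : ℝ} {u : Esp d × ℝ → ℝ}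

theorem neg (h : NeumannSol d θ C u) : NeumannSol d θ C fun p => -u p where
  continuousOn := h.continuousOn.neg
  harmonic := by
    refine ⟨h.harmonic.1.neg, fun p hp => ?_⟩
    have h1 := lapH_const_mul (-1) (h.harmonic.contDiffAt hp)
    rw [h.harmonic.2 p hp, mul_zero] at h1
    simpa using h1
  normal x hx := by
    obtain ⟨L, hL, hθ⟩ := h.normal x hx
    refine ⟨-L, ?_, by rwa [abs_neg]⟩
    refine (Tendsto.neg hL).congr fun t => ?_
    ring
  norm_fderiv_le p hp := by
    rw [fderiv_fun_neg, norm_neg]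
    exact h.norm_fderiv_le p hp

theorem abs_sub_le (h : NeumannSol d θ C u) (hC : 0 < C) {a : ℝ} (ha : 0 < a)
    {p q : Esp d × ℝ} (hp : p ∈ Metric.closedBall (0 : Esp d) (3 / 4) ×ˢ Icc a (1 / 4))
    (hq : q ∈ Metric.closedBall (0 : Esp d) (3 / 4) ×ˢ Icc a (1 / 4)) :
    |u q - u p| ≤ C * (a ^ (d + 1))⁻¹ * ‖q - p‖ := by
  have hmem : ∀ z ∈ Metric.closedBall (0 : Esp d) (3 / 4) ×ˢ Icc a (1 / 4),
      z ∈ upBall d (4 / 5) ∧ z ∈ upBall d 1 := by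
    rintro z ⟨h1, h2, h3⟩
    rw [mem_closedBall_zero_iff] at h1
    exact ⟨⟨by nlinarith [norm_nonneg z.1], ha.trans_le h2⟩,
      mem_upBall_one h1 (ha.trans_le h2) (by linarith)⟩
  have hconv : Convex ℝ (Metric.closedBall (0 : Esp d) (3 / 4) ×ˢ Icc a (1 / 4 : ℝ)) :=
    (convex_closedBall _ _).prod (convex_Icc _ _)
  rw [← Real.norm_eq_abs]
  refine hconv.norm_image_sub_le_of_norm_fderiv_le (𝕜 := ℝ) (fun z hz => ?_) (fun z hz => ?_) hp hq
  · exact (h.harmonic.contDiffAt (hmem z hz).2).differentiableAt (by norm_num)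
  · refine (h.norm_fderiv_le z (hmem z hz).1).trans ?_
    have := hz.2.1
    gcongr

theorem abs_sub_center_le (h : NeumannSol d θ C u) (hC : 0 < C) {p : Esp d × ℝ}
    (h1 : ‖p.1‖ ≤ 3 / 4) (h2 : 0 < p.2) (h3 : p.2 ≤ 1 / 4) :
    |u (0, 1 / 4) - u p| ≤ C * (p.2 ^ (d + 1))⁻¹ := by
  have hle := h.abs_sub_le hC h2 (p := p) (q := (0, 1 / 4)) ⟨by simpa using h1, le_rfl, h3⟩
    ⟨Metric.mem_closedBall_self (by norm_num), h3, le_rfl⟩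
  refine hle.trans (mul_le_of_le_one_right (by positivity) ?_)
  refine max_le ?_ ?_
  · simp only [Prod.fst_sub, zero_sub, norm_neg]
    linarith
  · rw [Prod.snd_sub, Real.norm_eq_abs, abs_le]
    constructor <;> linarith

end NeumannSol

end NeumannSolutions

section Boundedness

variable {d : ℕ} {θ C : ℝ} {u : Esp d × ℝ → ℝ}

/-- Slope of the barrier used with the singular weight `gap⁻¹ ^ k`. -/
def barrierSlope (d k : ℕ) : ℝ := 2 * k + d + 4

theorem four_le_barrierSlope (d k : ℕ) : 4 ≤ barrierSlope d k := by
  unfold barrierSlope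
  have : (0 : ℝ) ≤ k := by positivity
  have : (0 : ℝ) ≤ d := by positivity
  linarith

/-- The constant in the growth estimate `|u - u(0, 1/4)| ≤ growthConst * gap^{-(d + 1)}`. -/
noncomputable def growthConst (d : ℕ) (θ C : ℝ) : ℝ :=
  4 / 3 * (C + θ + 1) * (2 * barrierSlope d (d + 1)) ^ (d + 1)

theorem tendsto_vertical_slope {b : Esp d × ℝ → ℝ} {p : Esp d × ℝ} (h : DifferentiableAt ℝ b p) :
    Tendsto (fun t => (b (p.1, p.2 + t) - b p) / t) (𝓝[>] 0) (𝓝 (pdy d b p)) := by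
  have h1 := (hasDerivAt_vertical h).tendsto_slope_zero_right
  refine h1.congr fun t => ?_
  simp [div_eq_inv_mul]

namespace NeumannSol

theorem mem_of_mem_barrierRegion {M : ℝ} {p : Esp d × ℝ}
    (hp : p ∈ barrierRegion d M 0) {y : ℝ} (hy0 : 0 ≤ y) (hy : y ≤ 1 / 2) :
    (p.1, y) ∈ upBall d 1 ∪ flatBall d 1 :=
  mem_upBall_union_flatBall (norm_le_of_gap_nonneg hp.2.1) hy0 hy

theorem strictSubAt_const_sub (h : NeumannSol d θ C u) (c : ℝ) {p : Esp d × ℝ}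
    (hp1 : ‖p.1‖ ≤ 3 / 4) (hp2 : 0 ≤ p.2) (hp3 : p.2 ≤ 1 / 2) :
    StrictSubAt (fun q => c + (θ + 1) * q.2 - u q) p := by
  rcases hp2.eq_or_lt with h0 | h0
  · intro b hb _ hy hmax
    have hpdy : pdy d b p = 0 := hy.resolve_left (by rw [← h0]; exact lt_irrefl _)
    obtain ⟨L, hL, hLθ⟩ := h.normal p.1 (by linarith)
    have hp : p = (p.1, 0) := Prod.ext rfl h0.symm
    have hb' := tendsto_vertical_slope (hb.differentiableAt (by norm_num))
    have hlim : Tendsto (fun t => (θ + 1) - (u (p.1, t) - u (p.1, 0)) / t -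
        (b (p.1, p.2 + t) - b p) / t) (𝓝[>] 0) (𝓝 (θ + 1 - L - pdy d b p)) :=
      (tendsto_const_nhds.sub hL).sub hb'
    have hle : θ + 1 - L - pdy d b p ≤ 0 := by
      refine le_of_tendsto hlim ?_
      filter_upwards [hmax.eventually_vertical hp2, self_mem_nhdsWithin] with t ht (ht0 : 0 < t)
      have hup : u p = u (p.1, 0) := by rw [← hp]
      have hpt : u (p.1, p.2 + t) = u (p.1, t) := by rw [← h0, zero_add]
      simp only [hpt, hup] at ht
      rw [show (θ + 1) - (u (p.1, t) - u (p.1, 0)) / t - (b (p.1, p.2 + t) - b p) / t =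
        ((θ + 1) * t - (u (p.1, t) - u (p.1, 0)) - (b (p.1, p.2 + t) - b p)) / t by field_simp]
      refine div_nonpos_of_nonpos_of_nonneg ?_ ht0.le
      linarith
    rw [hpdy] at hle
    linarith [le_abs_self L]
  · have hu := h.harmonic.contDiffAt (mem_upBall_one hp1 h0 hp3)
    refine strictSubAt_of_harmonic h0 ((contDiff_affine c (θ + 1)).contDiffAt.sub hu) ?_
    rw [lapH_sub (contDiff_affine c (θ + 1)).contDiffAt hu, lapH_affine,
      h.harmonic.2 p (mem_upBall_one hp1 h0 hp3), sub_zero]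

theorem center_sub_le (h : NeumannSol d θ C u) (hθ : 0 < θ) (hC : 0 < C) {p : Esp d × ℝ}
    (hgap : 0 < gap p.1) (hp : 0 ≤ p.2) (hp' : p.2 ≤ 1 / 4) :
    u (0, 1 / 4) - u p ≤ growthConst d θ C * (gap p.1)⁻¹ ^ (d + 1) := by
  set M := barrierSlope d (d + 1) with hM
  have hM4 : 4 ≤ M := four_le_barrierSlope _ _
  have hM0 : 0 < M := by linarith
  rcases le_or_gt (2 * M * p.2) (gap p.1) with hle | hlt
  · have hpR : p ∈ barrierRegion d M 0 := ⟨hp, hgap.le, hle⟩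
    have hmain := le_of_strictSubAt_of_le_top (k := d + 1) (by lia) (M := M) (C₀ := C + θ + 1) rfl
      (by positivity) (g := fun q => u (0, 1 / 4) + (θ + 1) * q.2 - u q) ?_ ?_ ?_ hpR hgap
    · have : 0 ≤ (θ + 1) * p.2 := by positivity
      simp only [growthConst]
      linarith
    · refine (contDiff_affine _ _).continuous.continuousOn.sub (h.continuousOn.mono fun q hq => ?_)
      exact mem_of_mem_barrierRegion hq hq.1
        ((snd_le_of_mem_barrierRegion hM4 hq).trans (by norm_num))
    · intro q hq0 hq
      have hqR : q ∈ barrierRegion d M 0 := ⟨hq0.le, by rw [← hq]; positivity, hq.le⟩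
      have hq1 := snd_le_of_mem_barrierRegion hM4 hqR
      have h1 := (le_abs_self _).trans (h.abs_sub_center_le hC (norm_le_of_gap_nonneg hqR.2.1) hq0
        (by linarith))
      have h2 : q.2 ≤ (q.2 ^ (d + 1))⁻¹ := by
        have : 1 ≤ (q.2 ^ (d + 1))⁻¹ :=
          (one_le_inv₀ (by positivity)).2 (pow_le_one₀ hq0.le (by linarith))
        linarith
      have h3 : (θ + 1) * q.2 ≤ (θ + 1) * (q.2 ^ (d + 1))⁻¹ := by gcongr
      linarith
    · intro q hq _ _ _
      exact h.strictSubAt_const_sub _ (norm_le_of_gap_nonneg hq.2.1) hq.1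
        ((snd_le_of_mem_barrierRegion hM4 hq).trans (by norm_num))
  · have hp0 : 0 < p.2 := by
      by_contra! hneg
      nlinarith
    have h1 := (le_abs_self _).trans (h.abs_sub_center_le hC (norm_le_of_gap_nonneg hgap.le) hp0
      hp')
    have h2 : (p.2 ^ (d + 1))⁻¹ ≤ (2 * M) ^ (d + 1) * (gap p.1)⁻¹ ^ (d + 1) := by
      rw [← inv_pow, ← mul_pow]
      refine pow_le_pow_left₀ (by positivity) ?_ _
      rw [← div_eq_mul_inv, inv_eq_one_div, div_le_div_iff₀ hp0 hgap]
      linarith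
    have h3 : 0 ≤ (2 * M) ^ (d + 1) * (gap p.1)⁻¹ ^ (d + 1) := by positivity
    have h4 : C * (p.2 ^ (d + 1))⁻¹ ≤ C * ((2 * M) ^ (d + 1) * (gap p.1)⁻¹ ^ (d + 1)) := by gcongr
    have h5 : C * ((2 * M) ^ (d + 1) * (gap p.1)⁻¹ ^ (d + 1)) ≤
        4 / 3 * (C + θ + 1) * ((2 * M) ^ (d + 1) * (gap p.1)⁻¹ ^ (d + 1)) := by
      gcongr
      linarith
    simp only [growthConst]
    linarith

theorem abs_center_sub_le (h : NeumannSol d θ C u) (hθ : 0 < θ) (hC : 0 < C) {p : Esp d × ℝ}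
    (hgap : 0 < gap p.1) (hp : 0 ≤ p.2) (hp' : p.2 ≤ 1 / 4) :
    |u (0, 1 / 4) - u p| ≤ growthConst d θ C * (gap p.1)⁻¹ ^ (d + 1) := by
  have h1 := h.center_sub_le hθ hC hgap hp hp'
  have h2 := h.neg.center_sub_le hθ hC hgap hp hp'
  exact abs_le.2 ⟨by linarith, h1⟩

end NeumannSol

end Boundedness

section SymmetricDifference

variable {d : ℕ} {θ C : ℝ} {u : Esp d × ℝ → ℝ}

/-- The vertical symmetric difference quotient of the even reflection of `u`, corrected by a
concave function with a kink on `{y = h}`. -/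
noncomputable def symDiff (u : Esp d × ℝ → ℝ) (θ h : ℝ) (q : Esp d × ℝ) : ℝ :=
  (u (q.1, q.2 + h) - u (q.1, |q.2 - h|)) / (2 * h) - (θ + h) / h * min q.2 h

/-- The constant bounding `symDiff` on the graph bounding the barrier region. -/
noncomputable def symDiffConst (d : ℕ) (θ C : ℝ) : ℝ :=
  2 * growthConst d θ C + C * 2 ^ (d + 1)

namespace NeumannSol

theorem strictSubAt_symDiff (hu : NeumannSol d θ C u) {h : ℝ} (hh : h ∈ Ioo (0 : ℝ) (1 / 8))
    {p : Esp d × ℝ} (hp1 : ‖p.1‖ ≤ 3 / 4) (hp2 : 0 < p.2) (hp3 : p.2 ≤ 1 / 4) :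
    StrictSubAt (symDiff u θ h) p := by
  obtain ⟨hh0, hh1⟩ := hh
  have hplus : (p.1, 1 * p.2 + h) ∈ upBall d 1 :=
    mem_upBall_one hp1 (by simp only; linarith) (by simp only; linarith)
  have hCplus := contDiffAt_comp_vertical (hu.harmonic.contDiffAt hplus)
  have hLplus := lapH_comp_vertical u (one_mul 1) h p
  rw [hu.harmonic.2 _ hplus] at hLplus
  have hsmooth : ∀ σ s α β : ℝ, σ * σ = 1 → 0 < σ * p.2 + s → σ * p.2 + s ≤ 1 / 2 →
      (∀ᶠ q : Esp d × ℝ in 𝓝 p, |q.2 - h| = σ * q.2 + s ∧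
        (θ + h) / h * min q.2 h = α + β * q.2) → StrictSubAt (symDiff u θ h) p := by
    intro σ s α β hσ h1 h2 hev
    have hmem : (p.1, σ * p.2 + s) ∈ upBall d 1 := mem_upBall_one hp1 h1 h2
    have hCm := contDiffAt_comp_vertical (hu.harmonic.contDiffAt hmem)
    have hLm := lapH_comp_vertical u hσ s p
    rw [hu.harmonic.2 _ hmem] at hLm
    have hA := (contDiff_affine (d := d) α β).contDiffAt (x := p)
    have hD := contDiffAt_const (c := (2 * h)⁻¹) |>.mul (hCplus.sub hCm)
    refine (strictSubAt_of_harmonic (g := fun q => (2 * h)⁻¹ *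
      (u (q.1, 1 * q.2 + h) - u (q.1, σ * q.2 + s)) - (α + β * q.2)) hp2 (hD.sub hA) ?_).congr ?_
    · rw [lapH_sub hD hA, lapH_const_mul _ (hCplus.sub hCm), lapH_sub hCplus hCm, hLplus, hLm,
        lapH_affine]
      ring
    · filter_upwards [hev] with q hq
      rw [symDiff, hq.1, hq.2, one_mul]
      ring
  rcases lt_trichotomy p.2 h with hlt | heq | hgt
  · refine hsmooth (-1) h 0 ((θ + h) / h) (by norm_num) (by linarith) (by linarith) ?_
    filter_upwards [continuous_snd.continuousAt.eventually (gt_mem_nhds hlt)] with q hq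
    rw [abs_of_neg (by linarith), min_eq_left hq.le]
    constructor <;> ring
  · intro b hb _ _ hmax
    obtain ⟨L, hL, hLθ⟩ := hu.normal p.1 (by linarith)
    have hdu := hasDerivAt_vertical ((hu.harmonic.contDiffAt hplus).differentiableAt (by norm_num))
    have hdb := hasDerivAt_vertical (hb.differentiableAt (by norm_num))
    set D : ℝ → ℝ := fun t => (2 * h)⁻¹ * u (p.1, 1 * p.2 + h + t) - b (p.1, p.2 + t) with hD
    obtain ⟨s, hs⟩ : ∃ s, HasDerivAt D s 0 := ⟨_, (hdu.const_mul _).sub hdb⟩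
    have hs' : HasDerivAt (fun t => D (-t)) (-s) 0 := by
      have hs0 : HasDerivAt D s (-0) := by rwa [neg_zero]
      simpa [Function.comp_def] using hs0.comp (0 : ℝ) (hasDerivAt_neg (0 : ℝ))
    have hE := (hs.fun_add hs').tendsto_slope_zero_right
    rw [add_neg_cancel] at hE
    have hlim := (hE.sub (hL.const_mul h⁻¹)).add_const ((θ + h) / h)
    have hline : ∀ σ : ℝ, ∀ᶠ t in 𝓝[>] (0 : ℝ), symDiff u θ h (p.1, p.2 + σ * t) -
        b (p.1, p.2 + σ * t) ≤ symDiff u θ h p - b p := by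
      intro σ
      have hc : ContinuousAt (fun t : ℝ => (p.1, p.2 + σ * t)) 0 := by fun_prop
      have ht : Tendsto (fun t : ℝ => (p.1, p.2 + σ * t)) (𝓝[>] 0) (𝓝 p) := by
        simpa [ContinuousAt] using hc.tendsto.mono_left nhdsWithin_le_nhds
      exact ht.eventually (hmax.isLocalMax_of_pos hp2)
    have hle : (0 : ℝ) - h⁻¹ * L + (θ + h) / h ≤ 0 := by
      refine le_of_tendsto hlim ?_
      filter_upwards [hline 1, hline (-1), self_mem_nhdsWithin] with t h1 h2 (ht : 0 < t)
      have e0 : symDiff u θ h p = (u (p.1, p.2 + h) - u (p.1, 0)) / (2 * h) - (θ + h) / h * h := by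
        rw [symDiff, heq, sub_self, abs_zero, min_self]
      have e1 : symDiff u θ h (p.1, p.2 + 1 * t) =
          (u (p.1, p.2 + h + t) - u (p.1, t)) / (2 * h) - (θ + h) / h * h := by
        rw [symDiff, heq]
        simp only
        rw [min_eq_right (by linarith), show h + 1 * t - h = t by ring, abs_of_pos ht,
          show h + 1 * t + h = h + h + t by ring]
      have e2 : symDiff u θ h (p.1, p.2 + -1 * t) =
          (u (p.1, p.2 + h + -t) - u (p.1, t)) / (2 * h) - (θ + h) / h * (h - t) := by
        rw [symDiff, heq]
        simp only
        rw [min_eq_left (by linarith), show h + -1 * t - h = -t by ring, abs_neg, abs_of_pos ht,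
          show h + -1 * t + h = h + h + -t by ring, show h + -1 * t = h - t by ring]
      rw [e0, e1] at h1
      rw [e0, e2] at h2
      have key : t⁻¹ • (D (0 + t) + D (-(0 + t)) - (D 0 + D (-0))) -
          h⁻¹ * ((u (p.1, t) - u (p.1, 0)) / t) + (θ + h) / h =
          (((u (p.1, p.2 + h + t) - u (p.1, t)) / (2 * h) - (θ + h) / h * h -
              b (p.1, p.2 + 1 * t) -
              ((u (p.1, p.2 + h) - u (p.1, 0)) / (2 * h) - (θ + h) / h * h - b p)) +
            ((u (p.1, p.2 + h + -t) - u (p.1, t)) / (2 * h) - (θ + h) / h * (h - t) -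
              b (p.1, p.2 + -1 * t) -
              ((u (p.1, p.2 + h) - u (p.1, 0)) / (2 * h) - (θ + h) / h * h - b p))) / t := by
        simp only [hD, zero_add, neg_zero, add_zero, one_mul, neg_one_mul, smul_eq_mul]
        field_simp
        ring
      rw [key]
      exact div_nonpos_of_nonpos_of_nonneg (by linarith) ht.le
    have : h⁻¹ * L ≤ h⁻¹ * θ := by
      gcongr
      exact (le_abs_self L).trans hLθ
    rw [add_div, div_self hh0.ne', div_eq_inv_mul] at hle
    linarith
  · refine hsmooth 1 (-h) (θ + h) 0 (by norm_num) (by linarith) (by linarith) ?_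
    filter_upwards [continuous_snd.continuousAt.eventually (lt_mem_nhds hgt)] with q hq
    rw [abs_of_pos (by linarith), min_eq_right hq.le]
    constructor
    · ring
    · field_simp
      ring

theorem continuousOn_symDiff (hu : NeumannSol d θ C u) {h : ℝ} (hh : h ∈ Ioo (0 : ℝ) (1 / 8))
    {s : Set (Esp d × ℝ)} (hs : ∀ p ∈ s, ‖p.1‖ ≤ 3 / 4 ∧ 0 ≤ p.2 ∧ p.2 ≤ 1 / 4) :
    ContinuousOn (symDiff u θ h) s := by
  obtain ⟨hh0, hh1⟩ := hh
  have h1 : ContinuousOn (fun q : Esp d × ℝ => u (q.1, q.2 + h)) s := by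
    refine hu.continuousOn.comp (f := fun q : Esp d × ℝ => (q.1, q.2 + h)) (by fun_prop) ?_
    intro q hq
    obtain ⟨ha, hb, hc⟩ := hs q hq
    exact mem_upBall_union_flatBall ha (by simp only; linarith) (by simp only; linarith)
  have h2 : ContinuousOn (fun q : Esp d × ℝ => u (q.1, |q.2 - h|)) s := by
    refine hu.continuousOn.comp (f := fun q : Esp d × ℝ => (q.1, |q.2 - h|)) (by fun_prop) ?_
    intro q hq
    obtain ⟨ha, hb, hc⟩ := hs q hq
    exact mem_upBall_union_flatBall ha (abs_nonneg _)
      (abs_le.2 ⟨by linarith, by linarith⟩)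
  have h3 : ContinuousOn (fun q : Esp d × ℝ => (θ + h) / h * min q.2 h) s := by fun_prop
  exact ((h1.sub h2).div_const _).sub h3

theorem symDiff_le_top (hu : NeumannSol d θ C u) (hθ : 0 < θ) (hC : 0 < C) {h : ℝ}
    (hh : h ∈ Ioo (0 : ℝ) (1 / 8)) {M : ℝ} (hM : 4 ≤ M) {p : Esp d × ℝ} (hp : 0 < p.2)
    (htop : 2 * M * p.2 = gap p.1) :
    symDiff u θ h p ≤ symDiffConst d θ C * (p.2 ^ (d + 2))⁻¹ := by
  obtain ⟨hh0, hh1⟩ := hh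
  have hgap : 0 < gap p.1 := by rw [← htop]; positivity
  have hp1 := norm_le_of_gap_nonneg hgap.le
  have hp2 : p.2 ≤ 9 / 128 := snd_le_of_mem_barrierRegion hM ⟨hp.le, hgap.le, htop.le⟩
  have hK : 0 < growthConst d θ C := by
    have := four_le_barrierSlope d (d + 1)
    have : 0 < barrierSlope d (d + 1) := by linarith
    unfold growthConst
    positivity
  have hmin : 0 ≤ (θ + h) / h * min p.2 h :=
    mul_nonneg (by positivity) (le_min hp.le hh0.le)
  have hX : 0 < (p.2 ^ (d + 2))⁻¹ := by positivity
  suffices hq : (u (p.1, p.2 + h) - u (p.1, |p.2 - h|)) / (2 * h) ≤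
      symDiffConst d θ C * (p.2 ^ (d + 2))⁻¹ by
    unfold symDiff
    linarith
  unfold symDiffConst
  rw [add_mul, div_le_iff₀ (by positivity)]
  rcases le_or_gt (2 * h) p.2 with hle | hlt
  · have h1 := (le_abs_self _).trans (hu.abs_sub_le hC (a := p.2 / 2) (by linarith)
      (p := (p.1, p.2 - h)) (q := (p.1, p.2 + h))
      ⟨by simpa using hp1, by simp only; linarith, by simp only; linarith⟩
      ⟨by simpa using hp1, by simp only; linarith, by simp only; linarith⟩)
    have h2 : ‖((p.1, p.2 + h) : Esp d × ℝ) - (p.1, p.2 - h)‖ ≤ 2 * h := by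
      refine max_le (by simp; linarith) ?_
      rw [Prod.snd_sub, Real.norm_eq_abs, abs_le]
      constructor <;> simp only <;> linarith
    have h3 : C * ((p.2 / 2) ^ (d + 1))⁻¹ ≤ C * 2 ^ (d + 1) * (p.2 ^ (d + 2))⁻¹ := by
      rw [div_pow, inv_div, div_eq_mul_inv, ← mul_assoc]
      gcongr ?_ * ?_⁻¹
      exact pow_le_pow_of_le_one hp.le (by linarith) (by lia)
    rw [abs_of_nonneg (by linarith)]
    have h4 : C * ((p.2 / 2) ^ (d + 1))⁻¹ * ‖((p.1, p.2 + h) : Esp d × ℝ) - (p.1, p.2 - h)‖ ≤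
        C * 2 ^ (d + 1) * (p.2 ^ (d + 2))⁻¹ * (2 * h) := by gcongr
    have h5 : 0 ≤ 2 * growthConst d θ C * (p.2 ^ (d + 2))⁻¹ * (2 * h) := by positivity
    linarith
  · have h1 := hu.abs_center_sub_le hθ hC (p := (p.1, p.2 + h)) hgap (by simp only; linarith)
      (by simp only; linarith)
    have h2 := hu.abs_center_sub_le hθ hC (p := (p.1, |p.2 - h|)) hgap (abs_nonneg _)
      (abs_le.2 ⟨by linarith, by linarith⟩)
    rw [abs_le] at h1 h2
    have h3 : (gap p.1)⁻¹ ^ (d + 1) ≤ (p.2 ^ (d + 1))⁻¹ := by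
      rw [← inv_pow]
      gcongr
      rw [← htop]
      nlinarith
    have h4 : (p.2 ^ (d + 1))⁻¹ ≤ (p.2 ^ (d + 2))⁻¹ * (2 * h) := by
      rw [pow_succ p.2 (d + 1), mul_inv, mul_assoc]
      refine le_mul_of_one_le_right (by positivity) ?_
      rw [← div_eq_inv_mul, one_le_div hp]
      exact hlt.le
    have h5 := mul_le_mul_of_nonneg_left (h3.trans h4) hK.le
    have h6 : 0 ≤ C * 2 ^ (d + 1) * (p.2 ^ (d + 2))⁻¹ * (2 * h) := by positivity
    simp only at h1 h2
    linarith

end NeumannSol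

end SymmetricDifference

section LinearGrowth

variable {d : ℕ} {θ C : ℝ} {u : Esp d × ℝ → ℝ}

/-- Height of the slab in which the linear barrier is used. -/
noncomputable def slabHeight (d : ℕ) : ℝ := 11 / 64 / (2 * barrierSlope d (d + 2))

/-- Uniform bound of the symmetric difference quotients near `B'_{1/2}`. -/
noncomputable def slabBound (d : ℕ) (θ C : ℝ) : ℝ :=
  4 / 3 * symDiffConst d θ C * (2 * barrierSlope d (d + 2)) ^ (d + 2) * 6 ^ (d + 2)

theorem slabHeight_pos (d : ℕ) : 0 < slabHeight d := by
  have := four_le_barrierSlope d (d + 2)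
  unfold slabHeight
  positivity

theorem slabHeight_le (d : ℕ) : slabHeight d ≤ 1 / 8 := by
  have := four_le_barrierSlope d (d + 2)
  unfold slabHeight
  rw [div_le_iff₀ (by positivity)]
  linarith

theorem symDiffConst_pos (hθ : 0 < θ) (hC : 0 < C) : 0 < symDiffConst d θ C := by
  have := four_le_barrierSlope d (d + 1)
  unfold symDiffConst growthConst
  positivity

theorem slabBound_pos (hθ : 0 < θ) (hC : 0 < C) : 0 < slabBound d θ C := by
  have := four_le_barrierSlope d (d + 2)
  have := symDiffConst_pos (d := d) hθ hC
  unfold slabBound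
  positivity

namespace NeumannSol

theorem symDiff_le_linear (hu : NeumannSol d θ C u) (hθ : 0 < θ) (hC : 0 < C) {h : ℝ}
    (hh : h ∈ Ioo (0 : ℝ) (1 / 8)) {x : Esp d} (hx : ‖x‖ ≤ 1 / 2) {y : ℝ}
    (hy : y ∈ Icc 0 (slabHeight d)) :
    symDiff u θ h (x, y) ≤ slabBound d θ C * (d + 2) / slabHeight d * y := by
  set M := barrierSlope d (d + 2)
  have hM4 : 4 ≤ M := four_le_barrierSlope d (d + 2)
  have hρ := slabHeight_pos d
  have hρ' := slabHeight_le d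
  have hgap : ∀ p ∈ Metric.closedBall x (slabHeight d) ×ˢ Icc 0 (slabHeight d),
      11 / 64 ≤ gap p.1 := by
    rintro p ⟨h1, -⟩
    have h2 : ‖p.1‖ ≤ 5 / 8 := by
      rw [Metric.mem_closedBall, dist_eq_norm] at h1
      have := norm_le_norm_add_norm_sub' p.1 x
      linarith
    unfold gap
    nlinarith [norm_nonneg p.1]
  have hregion : ∀ p ∈ Metric.closedBall x (slabHeight d) ×ˢ Icc 0 (slabHeight d),
      p ∈ barrierRegion d M 0 := by
    intro p hp
    have h1 := hgap p hp
    refine ⟨hp.2.1, by linarith, le_trans ?_ h1⟩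
    have h2 : p.2 ≤ 11 / 64 / (2 * M) := hp.2.2
    rw [le_div_iff₀ (by positivity)] at h2
    linarith
  have hbounds : ∀ p ∈ barrierRegion d M 0, ‖p.1‖ ≤ 3 / 4 ∧ 0 ≤ p.2 ∧ p.2 ≤ 1 / 4 := fun p hp =>
    ⟨norm_le_of_gap_nonneg hp.2.1, hp.1, (snd_le_of_mem_barrierRegion hM4 hp).trans (by norm_num)⟩
  have hcont := hu.continuousOn_symDiff hh hbounds
  have hzero : ∀ z : Esp d, symDiff u θ h (z, 0) = 0 := by
    intro z
    simp [symDiff, abs_of_pos hh.1, hh.1.le]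
  have hsub : ∀ p ∈ barrierRegion d M 0, 0 < p.2 → StrictSubAt (symDiff u θ h) p := fun p hp hp0 =>
    hu.strictSubAt_symDiff hh (hbounds p hp).1 hp0 (hbounds p hp).2.2
  refine le_linear_of_strictSubAt hρ (slabBound_pos hθ hC) (hcont.mono hregion) (fun p hp => ?_)
    (fun z _ => (hzero z).le) (fun p hp => hsub p (hregion p hp)) hy
  have h1 := hgap p hp
  have hg0 : 0 < gap p.1 := by linarith
  have h2 := le_of_strictSubAt_of_le_top (k := d + 2) (by lia) (M := M) rfl
    (symDiffConst_pos hθ hC) hcont (fun q hq hq' => hu.symDiff_le_top hθ hC hh hM4 hq hq') ?_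
    (hregion p hp) hg0
  · refine h2.trans ?_
    have h3 : (gap p.1)⁻¹ ≤ 6 := by
      rw [inv_le_comm₀ hg0 (by norm_num)]
      linarith
    have h4 := symDiffConst_pos (d := d) hθ hC
    unfold slabBound
    gcongr
  · intro q hq _ _ hpos
    refine hsub q hq (hq.1.lt_of_ne fun h0 => ?_)
    have : (q.1, (0 : ℝ)) = q := by rw [h0]
    rw [← this, hzero] at hpos
    exact lt_irrefl _ hpos

theorem tendsto_symDiff {p : Esp d × ℝ} (hu : DifferentiableAt ℝ u p) (hp : 0 < p.2) :
    Tendsto (fun h => symDiff u θ h p) (𝓝[>] 0) (𝓝 (pdy d u p - θ)) := by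
  have hF := hasDerivAt_vertical hu
  have hF' : HasDerivAt (fun t : ℝ => u (p.1, p.2 + -t)) (-pdy d u p) 0 := by
    have h0 : HasDerivAt (fun t : ℝ => u (p.1, p.2 + t)) (pdy d u p) (-0) := by rwa [neg_zero]
    simpa [Function.comp_def] using h0.comp (0 : ℝ) (hasDerivAt_neg (0 : ℝ))
  have h1 := ((hF.fun_sub hF').tendsto_slope_zero_right.const_mul (2 : ℝ)⁻¹).sub
    ((tendsto_id.const_add θ).mono_left (nhdsWithin_le_nhds (s := Ioi (0 : ℝ))))
  have hlim : (2 : ℝ)⁻¹ * (pdy d u p - -pdy d u p) - (θ + 0) = pdy d u p - θ := by ring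
  rw [hlim] at h1
  refine h1.congr' ?_
  filter_upwards [Ioo_mem_nhdsGT hp] with t ht
  have ht0 : t ≠ 0 := ht.1.ne'
  rw [symDiff, abs_of_pos (by linarith [ht.2]), min_eq_right ht.2.le, div_mul_cancel₀ _ ht0,
    ← sub_eq_add_neg p.2]
  simp
  field_simp

theorem pdy_le (hu : NeumannSol d θ C u) (hθ : 0 < θ) (hC : 0 < C) {p : Esp d × ℝ}
    (hp : p ∈ upBall d (1 / 2)) :
    pdy d u p ≤ θ + (slabBound d θ C * (d + 2) / slabHeight d +
      C * (slabHeight d ^ (d + 1))⁻¹ / slabHeight d) * p.2 := by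
  obtain ⟨hp1, hp0⟩ := hp
  have hx : ‖p.1‖ ≤ 1 / 2 := by nlinarith [norm_nonneg p.1]
  have hy : p.2 ≤ 1 / 2 := by nlinarith [sq_nonneg ‖p.1‖]
  have hρ := slabHeight_pos d
  have hN := slabBound_pos (d := d) hθ hC
  have hdiff : DifferentiableAt ℝ u p :=
    (hu.harmonic.contDiffAt (mem_upBall_one (by linarith) hp0 hy)).differentiableAt (by norm_num)
  have hN' : 0 ≤ slabBound d θ C * (d + 2) / slabHeight d * p.2 := by positivity
  have hC' : 0 ≤ C * (slabHeight d ^ (d + 1))⁻¹ / slabHeight d * p.2 := by positivity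
  rcases le_or_gt p.2 (slabHeight d) with hle | hlt
  · have h1 : pdy d u p - θ ≤ slabBound d θ C * (d + 2) / slabHeight d * p.2 := by
      refine le_of_tendsto (tendsto_symDiff hdiff hp0) ?_
      filter_upwards [Ioo_mem_nhdsGT (show (0 : ℝ) < 1 / 8 by norm_num)] with h hh
      exact hu.symDiff_le_linear hθ hC hh hx ⟨hp0.le, hle⟩
    linarith
  · have h1 : pdy d u p ≤ C * (p.2 ^ (d + 1))⁻¹ := by
      rw [pdy_eq_fderiv hdiff]
      have h2 := (fderiv ℝ u p).le_opNorm (0, 1)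
      have h3 : ‖((0, 1) : Esp d × ℝ)‖ = 1 := by simp [Prod.norm_def]
      rw [h3, mul_one] at h2
      exact (le_abs_self _).trans (h2.trans (hu.norm_fderiv_le p ⟨by nlinarith, hp0⟩))
    have h2 : C * (p.2 ^ (d + 1))⁻¹ ≤ C * (slabHeight d ^ (d + 1))⁻¹ := by gcongr
    have h3 : C * (slabHeight d ^ (d + 1))⁻¹ ≤
        C * (slabHeight d ^ (d + 1))⁻¹ / slabHeight d * p.2 := by
      rw [div_mul_eq_mul_div, le_div_iff₀ hρ]
      gcongr
    linarith

theorem abs_pdy_le (hu : NeumannSol d θ C u) (hθ : 0 < θ) (hC : 0 < C) {p : Esp d × ℝ}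
    (hp : p ∈ upBall d (1 / 2)) :
    |pdy d u p| ≤ θ + (slabBound d θ C * (d + 2) / slabHeight d +
      C * (slabHeight d ^ (d + 1))⁻¹ / slabHeight d) * p.2 := by
  have h2 := hu.neg.pdy_le hθ hC hp
  have h3 : pdy d (fun q => -u q) p = -pdy d u p := by simp [pdy, deriv.fun_neg]
  rw [h3] at h2
  exact abs_le.2 ⟨by linarith, hu.pdy_le hθ hC hp⟩

end NeumannSol

end LinearGrowth

/-- **vertical derivative bound.** There is `C > 0`, depending only on `d`,
`θ`, `‖∇u‖_{L²(B₁⁺)}`, the Lipschitz constant of `f`, and `‖φ‖_{C^{1,1}}`, such that every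
solution `u` of the two-phase thin obstacle problem with `∇u ∈ L²(B₁⁺)` satisfies
`|∂_y u(x,y)| ≤ θ + Cy` in `B_{1/2}⁺`. -/
theorem statement13
    (d : ℕ) (hd : 1 ≤ d) (θ A L P : ℝ) (hθ : 0 < θ) :
    ∃ C > 0, ∀ (f : ℝ → ℝ) (φ : Esp d → ℝ) (u : Esp d × ℝ → ℝ),
      GoodF θ L f → C11Bound d P φ → TwoPhaseSolH d θ f φ u →
      IntegrableOn (fun p => gradSqH d u p) (upBall d 1) volume →
      (∫ p in upBall d 1, gradSqH d u p) ≤ A^2 →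
      ∀ p ∈ upBall d (1/2), |pdy d u p| ≤ θ + C * p.2 := by
  obtain ⟨C, hC, hgrad⟩ := exists_norm_fderiv_le d A
  have hρ := slabHeight_pos d
  have hN := slabBound_pos (d := d) hθ hC
  refine ⟨slabBound d θ C * (d + 2) / slabHeight d +
    C * (slabHeight d ^ (d + 1))⁻¹ / slabHeight d, by positivity, ?_⟩
  intro f φ u _ _ hu hint hle p hp
  have hsol : NeumannSol d θ C u := ⟨hu.1, hu.2.1, fun x hx => by
    obtain ⟨L', h1, h2, _⟩ := hu.2.2 x hx
    exact ⟨L', h1, h2⟩, hgrad u hu.2.1 hint hle⟩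
  exact hsol.abs_pdy_le hθ hC hp
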